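/- arXiv:0804.0865 — 4 statements merged into one kernel-verified Lean document; each statement's English description precedes it below -/
import Mathlib

section
/- Let d ∈ ℕ. For s ∈ ℕ, let χ_d(s) be the number of pairs (m,n) ∈ ℤ² such that there exist integers 0 ≤ i₁ ≤ ⋯ ≤ iₛ with (m,n) = Σₖ (f(-iₖ), f(-iₖ-1)) and Σₖ f(iₖ) ≤ d, and such that s is maximal with this property. Then χ_d(s) = 2s+1 if 0 ≤ s < d, χ_d(d) = d+1, and χ_d(s) = 0 if s > d. -/
/-- The weight `∑ f(i)` of the multiset with `a`, `b`, `c` copies of `j`, `j + 1`, `j + 2`. -/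
def windowWeight (N : ℕ × ℕ × ℕ × ℕ) : ℕ :=
  N.2.1 * Nat.fib (N.1 + 1) + N.2.2.1 * Nat.fib (N.1 + 2) + N.2.2.2 * Nat.fib (N.1 + 3)

/-- The lattice point represented by the multiset with `a`, `b`, `c` copies of
`j`, `j + 1`, `j + 2`. -/
def windowPoint (N : ℕ × ℕ × ℕ × ℕ) : ℤ × ℤ :=
  (N.2.1 * Int.fib (1 - N.1) + N.2.2.1 * Int.fib (-N.1) + N.2.2.2 * Int.fib (-N.1 - 1),
   N.2.1 * Int.fib (-N.1) + N.2.2.1 * Int.fib (-N.1 - 1) + N.2.2.2 * Int.fib (-N.1 - 2))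

/-- Normalized window multisets with `s` elements: the lowest index `j` does occur. -/
def IsWindow (s : ℕ) (N : ℕ × ℕ × ℕ × ℕ) : Prop :=
  1 ≤ N.2.1 ∧ N.2.1 + N.2.2.1 + N.2.2.2 = s

/-- `p` is a sum of `s` terms of total weight at most `d`. -/
def IsRep (d s : ℕ) (p : ℤ × ℤ) : Prop :=
  ∃ ι : Fin s → ℕ, Monotone ι ∧ p.1 = ∑ k, Int.fib (1 - ι k) ∧ p.2 = ∑ k, Int.fib (-ι k) ∧
    ∑ k, Int.fib (ι k + 1) ≤ d

theorem eq_intFib_add_one (f : ℤ → ℤ) (hf0 : f 0 = 1) (hf1 : f 1 = 1)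
    (hrec : ∀ i : ℤ, f (i + 2) = f (i + 1) + f i) (i : ℤ) : f i = Int.fib (i + 1) := by
  have key : ∀ n : ℕ, (f n = Int.fib (n + 1) ∧ f (n + 1) = Int.fib (n + 2)) ∧
      (f (-n) = Int.fib (-n + 1) ∧ f (-n + 1) = Int.fib (-n + 2)) := by
    intro n
    induction n with
    | zero => simp [hf0, hf1]
    | succ n ih =>
      obtain ⟨⟨h1, h2⟩, h3, h4⟩ := ih
      have e1 := hrec n
      have e2 := Int.fib_add_two (n + 1)
      have e3 := hrec (-n - 1)
      have e4 := Int.fib_add_two (-n)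
      push_cast
      ring_nf at *
      grind
  obtain ⟨n, rfl | rfl⟩ := i.eq_nat_or_neg
  · exact (key n).1.1
  · exact (key n).2.1

theorem intFib_neg_two_mul (n : ℤ) : Int.fib (-(2 * n)) = -Int.fib (2 * n) := by
  rw [Int.fib_neg, if_pos (even_two_mul n)]

theorem intFib_neg_two_mul_add_one (n : ℤ) : Int.fib (-(2 * n + 1)) = Int.fib (2 * n + 1) := by
  rw [Int.fib_neg, if_neg (by simp)]

theorem intFib_nonneg {n : ℤ} (hn : 0 ≤ n) : 0 ≤ Int.fib n := by
  rw [Int.fib_of_nonneg hn]; positivity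

theorem intFib_pos {n : ℤ} (hn : 0 < n) : 0 < Int.fib n := by
  have := intFib_nonneg hn.le
  have := Int.fib_eq_zero (n := n)
  grind

/-- Excess of the weight of a single index `i` over the linear functional that agrees with the
weight on the window `j, j + 1, j + 2`. -/
def excess (j i : ℤ) : ℤ :=
  Int.fib (i + 1) - (Int.fib (j - i + 1) * Int.fib (j + 1) + Int.fib (j - i) * Int.fib (j + 2) +
    2 * Int.fib (j + 2) * (1 - Int.fib (j - i + 1) - Int.fib (j - i)))

theorem excess_even (j n : ℤ) :
    excess j (j + 2 * n) = 2 * Int.fib (j + 2) * (Int.fib (2 * n - 1) - 1) := by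
  have h1 := Int.fib_add (j + 2) (2 * n - 1)
  have h2 := intFib_neg_two_mul n
  have h3 := intFib_neg_two_mul_add_one (n - 1)
  have h4 := Int.fib_add_two (2 * n - 1)
  have h5 := Int.fib_add_two (-(2 * n))
  have h6 := Int.fib_add_two (-(2 * n) - 1)
  have h7 := intFib_neg_two_mul_add_one n
  unfold excess
  ring_nf at *
  grind

theorem excess_odd (j n : ℤ) :
    excess j (j + 2 * n + 1) = 2 * (Int.fib (j + 1) * Int.fib (2 * n) +
      Int.fib (j + 2) * (Int.fib (2 * n - 1) - 1)) := by
  have h1 := Int.fib_add (j + 2) (2 * n)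
  have h2 := intFib_neg_two_mul n
  have h3 := intFib_neg_two_mul_add_one (n - 1)
  have h4 := Int.fib_add_two (2 * n - 1)
  have h5 := Int.fib_add_two (-(2 * n))
  have h6 := Int.fib_add_two (-(2 * n) - 1)
  have h7 := intFib_neg_two_mul_add_one n
  unfold excess
  ring_nf at *
  grind

theorem one_le_intFib_two_mul_sub_one (n : ℤ) : 1 ≤ Int.fib (2 * n - 1) := by
  have := Int.fib_two_mul_add_one_pos (n := n - 1)
  ring_nf at *
  omega

theorem excess_nonneg {j : ℤ} (hj : 0 ≤ j) (i : ℤ) : 0 ≤ excess j i := by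
  have hp := intFib_pos (n := j + 1) (by omega)
  have hq := intFib_nonneg hj
  have hr := Int.fib_add_two j
  obtain ⟨n, hn | hn⟩ : ∃ n, i = j + 2 * n ∨ i = j + 2 * n + 1 := ⟨(i - j) / 2, by omega⟩
  · have := one_le_intFib_two_mul_sub_one n
    rw [hn, excess_even]
    exact mul_nonneg (by omega) (by omega)
  · have := one_le_intFib_two_mul_sub_one n
    rw [hn, excess_odd]
    rcases le_or_gt 0 n with h | h
    · have := intFib_nonneg (n := 2 * n) (by omega)
      have := mul_nonneg hp.le this
      have : 0 ≤ Int.fib (j + 2) * (Int.fib (2 * n - 1) - 1) := mul_nonneg (by omega) (by omega)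
      omega
    · have h1 := intFib_neg_two_mul n
      have h2 := one_le_intFib_two_mul_sub_one (n + 1)
      have h3 := Int.fib_add_two (2 * n - 1)
      have h4 := intFib_pos (n := -(2 * n)) (by omega)
      ring_nf at *
      nlinarith [mul_nonneg hq (by omega : 0 ≤ Int.fib (-1 + n * 2) - 1)]

theorem excess_pos_of_lt {i j : ℤ} (hi : 0 ≤ i) (hij : i < j) : 0 < excess j i := by
  have hp := intFib_pos (n := j + 1) (by omega)
  have hq := intFib_pos (n := j) (by omega)
  have hr := Int.fib_add_two j
  obtain ⟨n, hn | hn⟩ : ∃ n, i = j + 2 * n ∨ i = j + 2 * n + 1 := ⟨(i - j) / 2, by omega⟩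
  all_goals
    have h1 := intFib_neg_two_mul n
    have h2 := one_le_intFib_two_mul_sub_one (n + 1)
    have h3 := Int.fib_add_two (2 * n - 1)
    have h4 := intFib_pos (n := -(2 * n)) (by omega)
    have h5 : 0 < Int.fib (2 * n - 1) - 1 := by ring_nf at *; omega
  · rw [hn, excess_even]
    exact mul_pos (by omega) h5
  · rw [hn, excess_odd]
    ring_nf at *
    nlinarith [mul_pos hq h5]

theorem excess_self (j : ℤ) : excess j j = 0 ∧ excess j (j + 1) = 0 ∧ excess j (j + 2) = 0 := by
  have h0 := excess_even j 0
  have h1 := excess_odd j 0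
  have h2 := excess_even j 1
  norm_num at h0 h1 h2
  exact ⟨h0, h1, h2⟩

theorem exists_monotone_sum_eq (j a b c : ℕ) :
    ∃ ι : Fin (a + b + c) → ℕ, Monotone ι ∧ ∀ g : ℕ → ℤ,
      ∑ k, g (ι k) = a * g j + b * g (j + 1) + c * g (j + 2) := by
  refine ⟨fun k ↦ if (k : ℕ) < a then j else if (k : ℕ) < a + b then j + 1 else j + 2, ?_, ?_⟩
  · intro x y hxy
    have : (x : ℕ) ≤ y := hxy
    grind
  · intro g
    rw [Fin.sum_univ_eq_sum_range
      (fun k ↦ g (if k < a then j else if k < a + b then j + 1 else j + 2)),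
      Finset.sum_range_add, Finset.sum_range_add]
    congr 1
    · congr 1
      · rw [Finset.sum_congr rfl (g := fun _ ↦ g j) (by intro x hx; simp_all)]
        simp
      · rw [Finset.sum_congr rfl (g := fun _ ↦ g (j + 1)) (by intro x hx; simp_all)]
        simp
    · rw [Finset.sum_congr rfl (g := fun _ ↦ g (j + 2)) (by
        intro x hx
        rw [if_neg (by omega), if_neg (by omega)])]
      simp

theorem exists_indices {s : ℕ} {N : ℕ × ℕ × ℕ × ℕ} (hs : N.2.1 + N.2.2.1 + N.2.2.2 = s) :
    ∃ ι : Fin s → ℕ, Monotone ι ∧ (windowPoint N).1 = ∑ k, Int.fib (1 - ι k) ∧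
      (windowPoint N).2 = ∑ k, Int.fib (-ι k) ∧ ∑ k, Int.fib (ι k + 1) = windowWeight N ∧
      ∀ g : ℕ → ℤ, ∑ k, g (ι k) =
        N.2.1 * g N.1 + N.2.2.1 * g (N.1 + 1) + N.2.2.2 * g (N.1 + 2) := by
  obtain ⟨j, a, b, c⟩ := N
  subst hs
  obtain ⟨ι, hι, h⟩ := exists_monotone_sum_eq j a b c
  refine ⟨ι, hι, ?_, ?_, ?_, h⟩
  · rw [h (fun i ↦ Int.fib (1 - i))]
    simp only [windowPoint]
    push_cast
    ring_nf
  · rw [h (fun i ↦ Int.fib (-i))]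
    simp only [windowPoint]
    push_cast
    ring_nf
  · rw [h (fun i ↦ Int.fib (i + 1))]
    simp only [windowWeight]
    push_cast [← Int.fib_natCast]
    ring_nf

theorem isRep_windowPoint {d s : ℕ} {N : ℕ × ℕ × ℕ × ℕ}
    (hs : N.2.1 + N.2.2.1 + N.2.2.2 = s) (hd : windowWeight N ≤ d) : IsRep d s (windowPoint N) := by
  obtain ⟨ι, hι, h1, h2, h3, -⟩ := exists_indices hs
  exact ⟨ι, hι, h1, h2, by rw [h3]; exact_mod_cast hd⟩

/-- The coordinates of a lattice point with respect to the terms with index `j`, `j + 1`. -/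
theorem coordinates_sum {t : ℕ} (ι : Fin t → ℕ) (j : ℤ) :
    (∑ k, Int.fib (1 - ι k)) * Int.fib (j + 1) + (∑ k, Int.fib (-ι k)) * Int.fib j =
      ∑ k, Int.fib (j - ι k + 1) := by
  rw [Finset.sum_mul, Finset.sum_mul, ← Finset.sum_add_distrib]
  refine Finset.sum_congr rfl fun k _ ↦ ?_
  have := Int.fib_add (j + 1) (-ι k)
  ring_nf at *
  linarith

theorem sum_excess_eq {s t : ℕ} {N : ℕ × ℕ × ℕ × ℕ} (hN : N.2.1 + N.2.2.1 + N.2.2.2 = s)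
    (ι : Fin t → ℕ) (h1 : (windowPoint N).1 = ∑ k, Int.fib (1 - ι k))
    (h2 : (windowPoint N).2 = ∑ k, Int.fib (-ι k)) :
    ∑ k, Int.fib (ι k + 1) = windowWeight N + 2 * Int.fib (N.1 + 2) * (t - s) +
      ∑ k, excess N.1 (ι k) := by
  have key : ∀ {r : ℕ} (κ : Fin r → ℕ), (windowPoint N).1 = ∑ k, Int.fib (1 - κ k) →
      (windowPoint N).2 = ∑ k, Int.fib (-κ k) →
      ∑ k, excess N.1 (κ k) = ∑ k, Int.fib (κ k + 1) -
        (((windowPoint N).1 * Int.fib (N.1 + 1) + (windowPoint N).2 * Int.fib N.1) *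
            Int.fib (N.1 + 1) +
          ((windowPoint N).1 * Int.fib N.1 + (windowPoint N).2 * Int.fib (N.1 - 1)) *
            Int.fib (N.1 + 2) +
          2 * Int.fib (N.1 + 2) * (r -
            ((windowPoint N).1 * Int.fib (N.1 + 1) + (windowPoint N).2 * Int.fib N.1) -
            ((windowPoint N).1 * Int.fib N.1 + (windowPoint N).2 * Int.fib (N.1 - 1)))) := by
    intro r κ e1 e2
    have c1 := coordinates_sum κ N.1
    have c2 := coordinates_sum κ (N.1 - 1)
    rw [← e1, ← e2] at c1 c2
    rw [sub_add_cancel] at c2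
    rw [c1, c2]
    simp only [excess, Finset.sum_sub_distrib, Finset.sum_add_distrib, ← Finset.mul_sum,
      ← Finset.sum_mul]
    simp only [sub_right_comm, sub_add_cancel, Finset.sum_const, Finset.card_univ, Fintype.card_fin]
    simp
  obtain ⟨κ, -, e1, e2, e3, e4⟩ := exists_indices hN
  have k1 := key ι h1 h2
  have k2 := key κ e1 e2
  rw [e4 (fun i ↦ excess N.1 i), e3] at k2
  obtain ⟨z0, z1, z2⟩ := excess_self N.1
  push_cast at k2
  rw [z0, z1, z2] at k2
  linarith

/-- The window representation has the least weight among those with `s` terms, and each further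
term costs at least `2 f(j + 1)`. -/
theorem windowWeight_add_le {s t : ℕ} {N : ℕ × ℕ × ℕ × ℕ} (hN : N.2.1 + N.2.2.1 + N.2.2.2 = s)
    (ι : Fin t → ℕ) (h1 : (windowPoint N).1 = ∑ k, Int.fib (1 - ι k))
    (h2 : (windowPoint N).2 = ∑ k, Int.fib (-ι k)) :
    windowWeight N + 2 * Int.fib (N.1 + 2) * (t - s) ≤ ∑ k, Int.fib (ι k + 1) := by
  rw [sum_excess_eq hN ι h1 h2]
  have : 0 ≤ ∑ k, excess N.1 (ι k) :=
    Finset.sum_nonneg fun k _ ↦ excess_nonneg (Int.natCast_nonneg _) _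
  linarith

theorem le_of_windowPoint_eq {s : ℕ} {N N' : ℕ × ℕ × ℕ × ℕ} (hN : IsWindow s N)
    (hN' : IsWindow s N') (h : windowPoint N = windowPoint N') : N'.1 ≤ N.1 := by
  by_contra! hlt
  obtain ⟨ι, -, h1, h2, h3, h4⟩ := exists_indices hN.2
  obtain ⟨κ, -, e1, e2, e3, -⟩ := exists_indices hN'.2
  have w1 := sum_excess_eq hN'.2 ι (h ▸ h1) (h ▸ h2)
  have w2 := windowWeight_add_le hN.2 κ (h ▸ e1) (h ▸ e2)
  rw [h4 (fun i ↦ excess N'.1 i), h3] at w1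
  rw [e3] at w2
  have p0 := excess_pos_of_lt (i := N.1) (j := N'.1) (by omega) (by omega)
  have p1 := excess_nonneg (j := N'.1) (by omega) (N.1 + 1)
  have p2 := excess_nonneg (j := N'.1) (by omega) (N.1 + 2)
  have q0 : 0 < (N.2.1 : ℤ) * excess N'.1 N.1 := mul_pos (by exact_mod_cast hN.1) p0
  have q1 : 0 ≤ (N.2.2.1 : ℤ) * excess N'.1 (N.1 + 1) := mul_nonneg (by omega) p1
  have q2 : 0 ≤ (N.2.2.2 : ℤ) * excess N'.1 (N.1 + 2) := mul_nonneg (by omega) p2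
  push_cast at w1
  linarith

theorem windowPoint_injOn {s : ℕ} {N N' : ℕ × ℕ × ℕ × ℕ} (hN : IsWindow s N)
    (hN' : IsWindow s N') (h : windowPoint N = windowPoint N') : N = N' := by
  have hj := le_antisymm (le_of_windowPoint_eq hN' hN h.symm) (le_of_windowPoint_eq hN hN' h)
  obtain ⟨ι, -, h1, h2, -, h4⟩ := exists_indices hN.2
  obtain ⟨κ, -, e1, e2, -, e4⟩ := exists_indices hN'.2
  have c1 := coordinates_sum ι N.1
  have c2 := coordinates_sum ι (N.1 - 1)
  have d1 := coordinates_sum κ N.1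
  have d2 := coordinates_sum κ (N.1 - 1)
  rw [← e1, ← e2, ← h, e4 (fun i ↦ Int.fib (N.1 - i + 1))] at d1
  rw [← e1, ← e2, ← h, e4 (fun i ↦ Int.fib (N.1 - 1 - i + 1))] at d2
  rw [← h1, ← h2, d1, h4 (fun i ↦ Int.fib (N.1 - i + 1))] at c1
  rw [← h1, ← h2, d2, h4 (fun i ↦ Int.fib (N.1 - 1 - i + 1))] at c2
  have hs := hN.2
  have hs' := hN'.2
  obtain ⟨j, a, b, c⟩ := N
  obtain ⟨j', a', b', c'⟩ := N'
  simp only at hj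
  subst hj
  ring_nf at c1 c2
  push_cast at c1 c2
  ring_nf at c1 c2
  simp at c1 c2 hs hs'
  simp only [Prod.mk.injEq, true_and]
  omega

/-- `p` has a normalized window representation with `s` terms. -/
def HasWindow (p : ℤ × ℤ) (s : ℕ) : Prop :=
  ∃ N, IsWindow s N ∧ windowPoint N = p

/-- Splitting the lowest index `j` into `j + 1` and `j + 2`. -/
theorem exists_split {s : ℕ} {N : ℕ × ℕ × ℕ × ℕ} (hN : IsWindow s N) :
    ∃ N', IsWindow (s + 1) N' ∧ windowPoint N' = windowPoint N ∧
      windowWeight N' = windowWeight N + 2 * Nat.fib (N.1 + 2) := by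
  obtain ⟨j, a, b, c⟩ := N
  obtain ⟨h1, h2⟩ := hN
  simp only at h1 h2
  have r1 := Int.fib_add_two (-j)
  have r2 := Int.fib_add_two (-j - 1)
  have r3 := Int.fib_add_two (-j - 2)
  have r4 := Nat.fib_add_two (n := j + 1)
  obtain ⟨a, rfl⟩ := Nat.exists_eq_add_of_le h1
  rcases Nat.eq_zero_or_pos a with rfl | ha
  · refine ⟨(j + 1, b + 1, c + 1, 0), ⟨by simp, by simp; omega⟩, ?_, ?_⟩
    · simp only [windowPoint, Prod.mk.injEq]
      push_cast
      ring_nf at *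
      constructor <;> grind
    · simp only [windowWeight]
      ring_nf at *
      grind
  · refine ⟨(j, a, b + 1, c + 1), ⟨ha, by simp; omega⟩, ?_, ?_⟩
    · simp only [windowPoint, Prod.mk.injEq]
      push_cast
      ring_nf at *
      constructor <;> grind
    · simp only [windowWeight]
      ring_nf at *
      grind

theorem intFib_one_sub_sub (i : ℕ) :
    Int.fib (1 - i) - Int.fib (-i) = (-1) ^ i * Int.fib (i + 1) := by
  have h := Int.fib_neg_natCast (i + 1)
  have h2 := Int.fib_add_two (-i - 1)
  rw [← Int.fib_natCast] at h
  push_cast at h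
  ring_nf at *
  linarith

theorem abs_sub_le_sum {t : ℕ} (ι : Fin t → ℕ) :
    |∑ k, Int.fib (1 - ι k) - ∑ k, Int.fib (-ι k)| ≤ ∑ k, Int.fib (ι k + 1) := by
  rw [← Finset.sum_sub_distrib]
  refine (Finset.abs_sum_le_sum_abs _ _).trans (Finset.sum_le_sum fun k _ ↦ ?_)
  rw [intFib_one_sub_sub, abs_mul, abs_neg_one_pow, one_mul,
    abs_of_nonneg (intFib_nonneg (by omega))]

theorem intFib_sub_le (i : ℕ) : Int.fib (2 - i) ≤ Int.fib (i + 1) := by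
  rcases i with _ | _ | i
  · simp
  · simp
  · have h := Int.fib_neg_natCast i
    have h2 : (i.fib : ℤ) ≤ (i + 3).fib := by exact_mod_cast Nat.fib_mono (by omega)
    have e1 : (2 - ((i + 1 + 1 : ℕ) : ℤ)) = -i := by push_cast; ring
    have e2 : (((i + 1 + 1 : ℕ) : ℤ) + 1) = (i + 3 : ℕ) := by push_cast; ring
    rw [e1, e2, h, Int.fib_natCast]
    rcases neg_one_pow_eq_or ℤ (i + 1) with h3 | h3 <;> rw [h3] <;> omega

theorem add_le_sum {t : ℕ} (ι : Fin t → ℕ) :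
    ∑ k, Int.fib (1 - ι k) + ∑ k, Int.fib (-ι k) ≤ ∑ k, Int.fib (ι k + 1) := by
  rw [← Finset.sum_add_distrib]
  refine Finset.sum_le_sum fun k _ ↦ ?_
  have h := Int.fib_add_two (-ι k)
  have h2 := intFib_sub_le (ι k)
  ring_nf at *
  linarith

/-- Either the lowest indices can be merged, or the window is of least weight among all
representations, with any number of terms. -/
theorem hasWindow_pred_or {s t : ℕ} {N : ℕ × ℕ × ℕ × ℕ} (hN : IsWindow (s + 1) N)
    (ι : Fin t → ℕ) (h1 : (windowPoint N).1 = ∑ k, Int.fib (1 - ι k))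
    (h2 : (windowPoint N).2 = ∑ k, Int.fib (-ι k)) :
    HasWindow (windowPoint N) s ∨ windowWeight N ≤ ∑ k, Int.fib (ι k + 1) := by
  have l1 := abs_sub_le_sum ι
  have l2 := add_le_sum ι
  rw [← h1, ← h2] at l1 l2
  clear h1 h2
  obtain ⟨j, a, b, c⟩ := N
  obtain ⟨n1, n2⟩ := hN
  simp only at n1 n2
  have r1 := Int.fib_add_two (-j)
  have r2 := Int.fib_add_two (-j - 1)
  have r3 := Int.fib_add_two (-j - 2)
  rcases Nat.eq_zero_or_pos b with rfl | hb
  · right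
    have q1 := intFib_one_sub_sub j
    have q2 := intFib_one_sub_sub (j + 2)
    have : (windowPoint (j, a, 0, c)).1 - (windowPoint (j, a, 0, c)).2 =
        (-1) ^ j * windowWeight (j, a, 0, c) := by
      simp only [windowPoint, windowWeight]
      push_cast [← Int.fib_natCast] at *
      rw [pow_add] at q2
      ring_nf at *
      grind
    rw [this, abs_mul, abs_neg_one_pow, one_mul, abs_of_nonneg (by omega)] at l1
    exact l1
  · obtain ⟨b, rfl⟩ := Nat.exists_eq_add_of_le hb
    obtain ⟨a, rfl⟩ := Nat.exists_eq_add_of_le n1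
    rcases Nat.eq_zero_or_pos c with rfl | hc
    · rcases j with _ | j
      · right
        simp [windowPoint, windowWeight] at l2 ⊢
        exact l2
      · left
        refine ⟨(j, 1, a, b), ⟨by simp, by simp; omega⟩, ?_⟩
        simp only [windowPoint, Prod.mk.injEq]
        push_cast at *
        ring_nf at *
        constructor <;> grind
    · left
      obtain ⟨c, rfl⟩ := Nat.exists_eq_add_of_le hc
      refine ⟨(j, a + 2, b, c), ⟨by simp, by simp; omega⟩, ?_⟩
      simp only [windowPoint, Prod.mk.injEq]
      push_cast at *
      ring_nf at *
      constructor <;> grind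

/-- A sum with at least one term, expanded in two consecutive terms of large index. -/
theorem exists_hasWindow {t : ℕ} (ht : 0 < t) (ι : Fin t → ℕ) :
    ∃ s, HasWindow (∑ k, Int.fib (1 - ι k), ∑ k, Int.fib (-ι k)) s := by
  set J := ∑ k, ι k
  have hJ : ∀ k, ι k ≤ J :=
    fun k ↦ Finset.single_le_sum (fun _ _ ↦ Nat.zero_le _) (Finset.mem_univ k)
  have e : ∀ k, (J : ℤ) - ι k = (J - ι k : ℕ) := fun k ↦ by have := hJ k; omega
  refine ⟨_, (J, ∑ k, Nat.fib (J - ι k + 1), ∑ k, Nat.fib (J - ι k), 0), ⟨?_, rfl⟩, ?_⟩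
  · have : (Finset.univ : Finset (Fin t)).Nonempty := ⟨⟨0, ht⟩, Finset.mem_univ _⟩
    exact Finset.sum_pos (fun k _ ↦ Nat.fib_pos.2 (by omega)) this
  · simp only [windowPoint, Nat.cast_sum, ← Int.fib_natCast]
    push_cast
    simp only [← e, zero_mul, add_zero, Finset.sum_mul, ← Finset.sum_add_distrib, Prod.mk.injEq]
    constructor <;> refine Finset.sum_congr rfl fun k _ ↦ ?_
    · have := Int.fib_add (J - ι k + 1) (-J)
      ring_nf at *
      linarith
    · have := Int.fib_add (J - ι k + 1) (-J - 1)
      ring_nf at *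
      linarith

/-- The points whose maximal number of terms is positive correspond to windows. -/
theorem isRep_maximal_iff {d s : ℕ} (hs : 0 < s) (p : ℤ × ℤ) :
    (IsRep d s p ∧ ∀ t, IsRep d t p → t ≤ s) ↔
      ∃ N, IsWindow s N ∧ windowWeight N ≤ d ∧ d < windowWeight N + 2 * Nat.fib (N.1 + 2) ∧
        windowPoint N = p := by
  constructor
  · rintro ⟨⟨ι, -, h1, h2, h3⟩, hmax⟩
    have hp : p = (∑ k, Int.fib (1 - ι k), ∑ k, Int.fib (-ι k)) := Prod.ext h1 h2
    have up : ∀ t, HasWindow p t → HasWindow p (t + 1) := by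
      rintro t ⟨N, hN, rfl⟩
      obtain ⟨N', hN', h, -⟩ := exists_split hN
      exact ⟨N', hN', h⟩
    have hex : ∃ t, HasWindow p t := hp ▸ exists_hasWindow hs ι
    have hw : HasWindow p s := by
      classical
      obtain hle | hlt := le_or_gt (Nat.find hex) s
      · exact Nat.le_induction (Nat.find_spec hex) (fun t _ ↦ up t) s hle
      · obtain ⟨t, ht⟩ := Nat.exists_eq_add_of_lt hlt
        have hspec := Nat.find_spec hex
        rw [ht] at hspec
        obtain ⟨N, hN, rfl⟩ := hspec
        rcases hasWindow_pred_or hN ι h1 h2 with h | h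
        · exact absurd h (Nat.find_min hex (by omega))
        · have := hmax _ (isRep_windowPoint hN.2 (by exact_mod_cast h.trans h3))
          omega
    obtain ⟨N, hN, rfl⟩ := hw
    refine ⟨N, hN, ?_, ?_, rfl⟩
    · have := windowWeight_add_le hN.2 ι h1 h2
      rw [sub_self, mul_zero, add_zero] at this
      exact_mod_cast this.trans h3
    · by_contra! hle
      obtain ⟨N', hN', h, hw⟩ := exists_split hN
      have := hmax _ (h ▸ isRep_windowPoint hN'.2 (hw ▸ hle))
      omega
  · rintro ⟨N, hN, h1, h2, rfl⟩
    refine ⟨isRep_windowPoint hN.2 h1, ?_⟩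
    rintro t ⟨ι, -, e1, e2, e3⟩
    by_contra! hlt
    have h := windowWeight_add_le hN.2 ι e1 e2
    have hpos := intFib_pos (n := N.1 + 2) (by omega)
    have h4 : 2 * Int.fib (N.1 + 2) * 1 ≤ 2 * Int.fib (N.1 + 2) * (t - s) :=
      mul_le_mul_of_nonneg_left (by omega) (by omega)
    zify [← Int.fib_natCast] at h2
    linarith

/-- The next window, in order of weight, after the given one is no longer maximal. -/
def nextWindow : ℕ × ℕ × ℕ × ℕ → ℕ × ℕ × ℕ × ℕ
  | (j, a + 3, b, c) => (j, a + 1, b, c + 2)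
  | (j, 2, b + 1, c) => (j + 1, b + 1, c + 2, 0)
  | (j, 2, 0, c) => (j + 2, c + 2, 0, 0)
  | (j, 1, b + 1, c) => (j + 1, b + 1, c, 1)
  | (j, 1, 0, c + 1) => (j + 2, c + 1, 1, 0)
  | (j, 1, 0, 0) => (j + 3, 1, 0, 0)
  | N => N

/-- The inverse of `nextWindow` away from the initial windows. -/
def prevWindow : ℕ × ℕ × ℕ × ℕ → ℕ × ℕ × ℕ × ℕ
  | (j, a, b, c + 2) => (j, a + 2, b, c)
  | (j, a, b, 1) => (j - 1, 1, a, b)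
  | (j, a, b + 2, 0) => (j - 1, 2, a, b)
  | (j, a, 1, 0) => (j - 2, 1, 0, a)
  | (j, a + 2, 0, 0) => (j - 2, 2, 0, a)
  | (j, _, 0, 0) => (j - 3, 1, 0, 0)

/-- The windows that are not of the form `nextWindow N`. -/
def IsInitial (N : ℕ × ℕ × ℕ × ℕ) : Prop :=
  (N.1 = 0 ∧ N.2.2.2 ≤ 1) ∨ (N.1 = 1 ∧ N.2.2.2 = 0 ∧ N.2.2.1 ≤ 1) ∨
    (N.1 = 2 ∧ N.2.1 = 1 ∧ N.2.2.1 = 0 ∧ N.2.2.2 = 0)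

theorem nextWindow_spec {s : ℕ} {N : ℕ × ℕ × ℕ × ℕ} (hN : IsWindow s N) :
    IsWindow s (nextWindow N) ∧ ¬ IsInitial (nextWindow N) ∧ prevWindow (nextWindow N) = N ∧
      windowWeight (nextWindow N) = windowWeight N + 2 * Nat.fib (N.1 + 2) := by
  obtain ⟨j, a, b, c⟩ := N
  have r1 := Nat.fib_add_two (n := j + 1)
  have r2 := Nat.fib_add_two (n := j + 2)
  have r3 := Nat.fib_add_two (n := j)
  rcases a with _ | _ | _ | a
  · exact absurd hN.1 (by simp)
  · rcases b with _ | b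
    · rcases c with _ | c
      · refine ⟨by simpa [nextWindow, IsWindow] using hN, by simp [nextWindow, IsInitial], rfl, ?_⟩
        simp only [nextWindow, windowWeight]
        grind
      · simp_all [nextWindow, IsWindow, IsInitial, prevWindow, windowWeight, add_assoc]
        grind
    · simp_all [nextWindow, IsWindow, IsInitial, prevWindow, windowWeight, add_assoc]
      grind
  · rcases b with _ | b <;>
      simp_all [nextWindow, IsWindow, IsInitial, prevWindow, windowWeight, add_assoc] <;> grind
  · simp_all [nextWindow, IsWindow, IsInitial, prevWindow, windowWeight, add_assoc]
    grind

theorem prevWindow_spec {s : ℕ} {N : ℕ × ℕ × ℕ × ℕ} (hN : IsWindow s N) (hI : ¬ IsInitial N) :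
    IsWindow s (prevWindow N) ∧ nextWindow (prevWindow N) = N := by
  obtain ⟨j, a, b, c⟩ := N
  rcases a with _ | a
  · exact absurd hN.1 (by simp)
  rcases c with _ | _ | c
  · rcases b with _ | _ | b
    · rcases a with _ | a
      · rcases j with _ | _ | _ | j <;>
          simp_all [nextWindow, IsWindow, IsInitial, prevWindow] <;> grind
      · rcases j with _ | _ | j <;>
          simp_all [nextWindow, IsWindow, IsInitial, prevWindow]
        grind
    · rcases j with _ | _ | j <;>
        simp_all [nextWindow, IsWindow, IsInitial, prevWindow]
      grind
    · rcases j with _ | j <;>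
        simp_all [nextWindow, IsWindow, IsInitial, prevWindow]
      grind
  · rcases j with _ | j <;>
      simp_all [nextWindow, IsWindow, IsInitial, prevWindow]
    grind
  · simp_all [nextWindow, IsWindow, IsInitial, prevWindow]
    grind

theorem finite_windows (s d : ℕ) : {N | IsWindow s N ∧ windowWeight N ≤ d}.Finite := by
  refine (Set.finite_Iic ((d, s, s, s) : ℕ × ℕ × ℕ × ℕ)).subset ?_
  rintro ⟨j, a, b, c⟩ ⟨⟨h1, h2⟩, h3⟩
  simp only [windowWeight] at h1 h2 h3
  have h4 := Nat.le_fib_add_one (j + 1)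
  have h5 := Nat.le_mul_of_pos_left (Nat.fib (j + 1)) h1
  simp only [Set.mem_Iic, Prod.mk_le_mk]
  omega

/-- The number of maximal windows is the number of initial windows. -/
theorem ncard_maximal_windows (s d : ℕ) :
    {N | IsWindow s N ∧ windowWeight N ≤ d ∧ d < windowWeight N + 2 * Nat.fib (N.1 + 2)}.ncard =
      {N | IsWindow s N ∧ windowWeight N ≤ d ∧ IsInitial N}.ncard := by
  have hfin := finite_windows s d
  have h1 := Set.ncard_inter_add_ncard_sdiff_eq_ncard {N | IsWindow s N ∧ windowWeight N ≤ d}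
    {N | d < windowWeight N + 2 * Nat.fib (N.1 + 2)} hfin
  have h2 := Set.ncard_inter_add_ncard_sdiff_eq_ncard {N | IsWindow s N ∧ windowWeight N ≤ d}
    {N | IsInitial N} hfin
  have h3 : ({N | IsWindow s N ∧ windowWeight N ≤ d} \
      {N | d < windowWeight N + 2 * Nat.fib (N.1 + 2)}).ncard =
      ({N | IsWindow s N ∧ windowWeight N ≤ d} \ {N | IsInitial N}).ncard := by
    refine Set.ncard_congr (fun N _ ↦ nextWindow N) ?_ ?_ ?_
    · rintro N ⟨⟨hN, -⟩, hd⟩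
      obtain ⟨h1, h2, -, h4⟩ := nextWindow_spec hN
      exact ⟨⟨h1, h4 ▸ not_lt.1 hd⟩, h2⟩
    · rintro N N' ⟨⟨hN, -⟩, -⟩ ⟨⟨hN', -⟩, -⟩ h
      rw [← (nextWindow_spec hN).2.2.1, h, (nextWindow_spec hN').2.2.1]
    · rintro N ⟨⟨hN, hd⟩, hI⟩
      obtain ⟨h1, h2⟩ := prevWindow_spec hN hI
      have h3 := (nextWindow_spec h1).2.2.2
      rw [h2] at h3
      refine ⟨prevWindow N, ⟨⟨h1, ?_⟩, ?_⟩, h2⟩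
      · change windowWeight N ≤ d at hd
        omega
      · change ¬ d < _
        rw [← h3]
        exact not_lt.2 hd
  simp only [and_assoc, Set.inter_def, Set.mem_ofPred_eq] at h1 h2
  omega

theorem IsInitial.weight {s : ℕ} {N : ℕ × ℕ × ℕ × ℕ} (hI : IsInitial N) (hN : IsWindow s N) :
    windowWeight N = s ∨ windowWeight N = s + 1 := by
  obtain ⟨j, a, b, c⟩ := N
  obtain ⟨h1, h2⟩ := hN
  simp only [IsInitial] at hI h1 h2
  rcases hI with ⟨rfl, h⟩ | ⟨rfl, rfl, h⟩ | ⟨rfl, rfl, rfl, rfl⟩ <;>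
    norm_num [windowWeight, Nat.fib_add_two] <;> omega

theorem ncard_initial_weight_eq {s : ℕ} (hs : 0 < s) :
    {N | IsWindow s N ∧ windowWeight N = s ∧ IsInitial N}.ncard = s + 1 := by
  have h : {N | IsWindow s N ∧ windowWeight N = s ∧ IsInitial N} =
      (fun k ↦ if k < s then (0, k + 1, s - 1 - k, 0) else (1, s, 0, 0)) '' Set.Iio (s + 1) := by
    ext ⟨j, a, b, c⟩
    simp only [IsWindow, windowWeight, IsInitial, Set.mem_ofPred_eq, Set.mem_image, Set.mem_Iio]
    constructor
    · rintro ⟨⟨h1, h2⟩, h3, ⟨rfl, h⟩ | ⟨rfl, rfl, h⟩ | ⟨rfl, rfl, rfl, rfl⟩⟩ <;>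
        norm_num [Nat.fib_add_two] at h3
      · exact ⟨a - 1, by omega, by rw [if_pos (by omega)]; grind⟩
      · exact ⟨s, by omega, by rw [if_neg (by omega)]; grind⟩
      · omega
    · rintro ⟨k, hk, h⟩
      split_ifs at h <;> simp only [Prod.mk.injEq] at h <;> obtain ⟨rfl, rfl, rfl, rfl⟩ := h <;>
        norm_num [Nat.fib_add_two] <;> omega
  rw [h, Set.InjOn.ncard_image, Set.ncard_Iio_nat]
  intro k hk l hl h
  simp only [Set.mem_Iio] at hk hl
  simp only at h
  split_ifs at h <;> simp only [Prod.mk.injEq] at h <;> omega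

theorem ncard_initial_weight_eq_succ {s : ℕ} (hs : 0 < s) :
    {N | IsWindow s N ∧ windowWeight N = s + 1 ∧ IsInitial N}.ncard = s := by
  have h : {N | IsWindow s N ∧ windowWeight N = s + 1 ∧ IsInitial N} =
      (fun k ↦ if k + 1 < s then (0, k + 1, s - 2 - k, 1) else
        if s = 1 then (2, 1, 0, 0) else (1, s - 1, 1, 0)) '' Set.Iio s := by
    ext ⟨j, a, b, c⟩
    simp only [IsWindow, windowWeight, IsInitial, Set.mem_ofPred_eq, Set.mem_image, Set.mem_Iio]
    constructor
    · rintro ⟨⟨h1, h2⟩, h3, ⟨rfl, h⟩ | ⟨rfl, rfl, h⟩ | ⟨rfl, rfl, rfl, rfl⟩⟩ <;>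
        norm_num [Nat.fib_add_two] at h3
      · exact ⟨a - 1, by omega, by rw [if_pos (by omega)]; grind⟩
      · exact ⟨s - 1, by omega, by
          rw [if_neg (by omega), if_neg (by omega)]; grind⟩
      · exact ⟨0, by omega, by rw [if_neg (by omega), if_pos (by omega)]⟩
    · rintro ⟨k, hk, h⟩
      split_ifs at h <;> simp only [Prod.mk.injEq] at h <;> obtain ⟨rfl, rfl, rfl, rfl⟩ := h <;>
        norm_num [Nat.fib_add_two] <;> omega
  rw [h, Set.InjOn.ncard_image, Set.ncard_Iio_nat]
  intro k hk l hl h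
  simp only [Set.mem_Iio] at hk hl
  simp only at h
  split_ifs at h <;> simp only [Prod.mk.injEq] at h <;> omega

theorem ncard_initial {s : ℕ} (hs : 0 < s) (d : ℕ) :
    {N | IsWindow s N ∧ windowWeight N ≤ d ∧ IsInitial N}.ncard =
      if s < d then 2 * s + 1 else if s = d then d + 1 else 0 := by
  have e1 := ncard_initial_weight_eq hs
  have e2 := ncard_initial_weight_eq_succ hs
  split_ifs with h1 h2
  · have h : {N | IsWindow s N ∧ windowWeight N ≤ d ∧ IsInitial N} =
        {N | IsWindow s N ∧ windowWeight N = s ∧ IsInitial N} ∪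
        {N | IsWindow s N ∧ windowWeight N = s + 1 ∧ IsInitial N} := by
      ext N
      have := fun hI hN ↦ IsInitial.weight (s := s) (N := N) hI hN
      simp only [Set.mem_union, Set.mem_ofPred_eq]
      grind
    rw [h, Set.ncard_union_eq ?_ (Set.finite_of_ncard_pos (by omega))
      (Set.finite_of_ncard_pos (by omega)), e1, e2]
    · omega
    · rw [Set.disjoint_left]
      rintro N ⟨-, h, -⟩ ⟨-, h', -⟩
      omega
  · subst h2
    rw [← e1]
    congr 1
    ext N
    have := fun hI hN ↦ IsInitial.weight (s := s) (N := N) hI hN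
    simp only [Set.mem_ofPred_eq]
    grind
  · rw [Set.ncard_eq_zero ((finite_windows s d).subset fun N h ↦ ⟨h.1, h.2.1⟩),
      Set.eq_empty_iff_forall_notMem]
    rintro N ⟨hN, hd, hI⟩
    have := hI.weight hN
    omega

theorem ncard_isRep_maximal_of_pos {s : ℕ} (hs : 0 < s) (d : ℕ) :
    {p | IsRep d s p ∧ ∀ t, IsRep d t p → t ≤ s}.ncard =
      if s < d then 2 * s + 1 else if s = d then d + 1 else 0 := by
  rw [← ncard_initial hs, ← ncard_maximal_windows]
  have h : {p | IsRep d s p ∧ ∀ t, IsRep d t p → t ≤ s} = windowPoint '' {N | IsWindow s N ∧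
      windowWeight N ≤ d ∧ d < windowWeight N + 2 * Nat.fib (N.1 + 2)} := by
    ext p
    simp only [Set.mem_ofPred_eq, Set.mem_image, isRep_maximal_iff hs, and_assoc]
  rw [h, Set.InjOn.ncard_image]
  intro N hN N' hN' h
  exact windowPoint_injOn hN.1 hN'.1 h

theorem isRep_maximal_zero (d : ℕ) :
    {p | IsRep d 0 p ∧ ∀ t, IsRep d t p → t ≤ 0} = {(0, 0)} := by
  ext p
  simp only [Set.mem_ofPred_eq, Set.mem_singleton_iff]
  constructor
  · rintro ⟨⟨ι, -, h1, h2, -⟩, -⟩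
    exact Prod.ext (by simpa using h1) (by simpa using h2)
  · rintro rfl
    refine ⟨⟨fun _ ↦ 0, fun _ _ _ ↦ le_rfl, by simp, by simp, by simp⟩, ?_⟩
    rintro t ⟨ι, -, h1, h2, -⟩
    have hJ : ∀ k, ι k ≤ ∑ k, ι k :=
      fun k ↦ Finset.single_le_sum (fun _ _ ↦ Nat.zero_le _) (Finset.mem_univ k)
    have h := coordinates_sum ι ((∑ k, ι k : ℕ) : ℤ)
    rw [← h1, ← h2, zero_mul, zero_mul, add_zero] at h
    by_contra! ht
    have hne : (Finset.univ : Finset (Fin t)).Nonempty := ⟨⟨0, ht⟩, Finset.mem_univ _⟩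
    exact (Finset.sum_pos (fun k _ ↦ intFib_pos (by have := hJ k; omega)) hne).ne h

theorem stmt_12 (f : ℤ → ℤ) (hf0 : f 0 = 1) (hf1 : f 1 = 1)
    (hrec : ∀ i : ℤ, f (i + 2) = f (i + 1) + f i)
    (d : ℕ)
    (Rep : ℕ → ℤ × ℤ → Prop)
    (hRep : ∀ (s : ℕ) (p : ℤ × ℤ), Rep s p ↔ ∃ ι : Fin s → ℕ, Monotone ι ∧
      p.1 = ∑ k : Fin s, f (-(ι k : ℤ)) ∧
      p.2 = ∑ k : Fin s, f (-(ι k : ℤ) - 1) ∧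
      ∑ k : Fin s, f (ι k : ℤ) ≤ (d : ℤ))
    (χ : ℕ → ℕ)
    (hχ : ∀ s : ℕ, χ s = {p : ℤ × ℤ | Rep s p ∧ ∀ t : ℕ, Rep t p → t ≤ s}.ncard) :
    ∀ s : ℕ, (s < d → χ s = 2 * s + 1) ∧ (s = d → χ s = d + 1) ∧ (d < s → χ s = 0) := by
  have hRep' : ∀ s p, Rep s p ↔ IsRep d s p := by
    intro s p
    rw [hRep, IsRep]
    simp only [eq_intFib_add_one f hf0 hf1 hrec, sub_add_cancel, neg_add_eq_sub]
  intro s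
  rw [hχ]
  simp only [hRep']
  rcases Nat.eq_zero_or_pos s with rfl | hs
  · rw [isRep_maximal_zero, Set.ncard_singleton]
    omega
  · rw [ncard_isRep_maximal_of_pos hs]
    split_ifs <;> omega
end

section
/- Let d₁,d₂ ∈ ℕ. For s ∈ ℕ, let χ_{d₁,d₂}(s) be the number of (m,n) ∈ ℤ² such that there exist integers 0 ≤ i₁ ≤ ⋯ ≤ iₛ with (m,n) = Σₖ (f(-iₖ), f(-iₖ-1)), Σₖ f(iₖ-2) ≤ d₁ and Σₖ f(iₖ-1) ≤ d₂, with s maximal for (m,n). Then χ_{d₁,d₂}(s) = 2·min{d₁, d₂, s, d₁+d₂−s} + 1 if 0 ≤ s ≤ d₁+d₂, and 0 if s > d₁+d₂. -/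
/-- The recurrence `w j = w (j + 1) + w (j + 2)`. -/
def IsBackward (w : ℕ → ℤ) : Prop := ∀ j, w j = w (j + 1) + w (j + 2)

/-- The recurrence `w (j + 2) = w (j + 1) + w j`. -/
def IsForward (w : ℕ → ℤ) : Prop := ∀ j, w (j + 2) = w (j + 1) + w j

/-- A tuple `(i, a, b, c)` encodes the multiset with `a + 1` copies of `i`, `b` copies of `i + 1` and
`c` copies of `i + 2`; this is its cardinality. -/
def windowSize : ℕ × ℕ × ℕ × ℕ → ℕ
  | (_, a, b, c) => a + 1 + b + c

/-- The sum of `w` over the multiset encoded by a tuple. -/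
def windowSum (w : ℕ → ℤ) : ℕ × ℕ × ℕ × ℕ → ℤ
  | (i, a, b, c) => (a + 1) * w i + b * w (i + 1) + c * w (i + 2)

/-- Replace one copy of the least element `i` by `i + 1` and `i + 2`. -/
def expand : ℕ × ℕ × ℕ × ℕ → ℕ × ℕ × ℕ × ℕ
  | (i, 0, b, c) => (i + 1, b, c + 1, 0)
  | (i, a + 1, b, c) => (i, a, b + 1, c + 1)

/-- Replace one copy of the least element `i` and one copy of `i + 1` by `i + 2`. -/
def merge : ℕ × ℕ × ℕ × ℕ → ℕ × ℕ × ℕ × ℕ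
  | (i, a, 0, c) => (i, a, 0, c)
  | (i, a + 1, b + 1, c) => (i, a, b, c + 1)
  | (i, 0, b + 2, c) => (i + 1, b, c + 1, 0)
  | (i, 0, 1, c) => (i + 2, c, 0, 0)

theorem windowSize_expand (R) : windowSize (expand R) = windowSize R + 1 := by
  obtain ⟨i, _ | a, b, c⟩ := R <;> simp only [expand, windowSize] <;> omega

theorem windowSum_expand_of_isBackward {w} (hw : IsBackward w) (R) :
    windowSum w (expand R) = windowSum w R := by
  obtain ⟨i, _ | a, b, c⟩ := R <;> simp only [expand, windowSum] <;> push_cast <;>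
    linear_combination -(hw i)

theorem windowSum_le_windowSum_expand {w} (hw : IsForward w) (h0 : ∀ j, 0 ≤ w j) (R) :
    windowSum w R ≤ windowSum w (expand R) := by
  obtain ⟨i, _ | a, b, c⟩ := R <;> simp only [expand, windowSum] <;> push_cast <;>
    linarith [hw i, h0 (i + 1)]

theorem windowSum_le_windowSum_iterate_expand {w} (hw : IsForward w) (h0 : ∀ j, 0 ≤ w j) (k R) :
    windowSum w R ≤ windowSum w (expand^[k] R) := by
  induction k with
  | zero => rfl
  | succ k ih =>
    rw [Function.iterate_succ_apply']
    exact ih.trans (windowSum_le_windowSum_expand hw h0 _)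

theorem windowSum_iterate_expand {w} (hw : IsBackward w) (k R) :
    windowSum w (expand^[k] R) = windowSum w R := by
  induction k with
  | zero => rfl
  | succ k ih => rw [Function.iterate_succ_apply', windowSum_expand_of_isBackward hw, ih]

theorem windowSize_iterate_expand (k R) : windowSize (expand^[k] R) = windowSize R + k := by
  induction k with
  | zero => rfl
  | succ k ih => rw [Function.iterate_succ_apply', windowSize_expand, ih, add_assoc]

theorem windowSum_merge {w} (hw : IsForward w) (R) : windowSum w (merge R) = windowSum w R := by
  obtain ⟨i, _ | a, _ | _ | b, c⟩ := R <;> simp only [merge, windowSum] <;> push_cast <;>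
    linear_combination hw i

/-! ### Concentrating a multiset of indices -/

theorem exists_concentration_even (i k : ℕ) : ∃ P : Multiset ℕ, P.card = k + 3 ∧
    (∀ w, IsBackward w → (P.map w).sum = w i + w (i + 2 * k + 4)) ∧
    ∀ w, IsForward w → (P.map w).sum = w i + w (i + 2 * k + 4) := by
  have key : ∀ k, ∃ Q : Multiset ℕ, Q.card = k + 1 ∧ ∀ w : ℕ → ℤ,
      (∀ j, w j + w (j + 4) = 3 * w (j + 2)) →
      (Q.map w).sum = w i - w (i + 2) + w (i + 2 * k + 4) - w (i + 2 * k + 2) := by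
    intro k
    induction k with
    | zero =>
      refine ⟨{i + 2}, rfl, fun w hw => ?_⟩
      have := hw i
      simp only [Multiset.map_singleton, Multiset.sum_singleton, mul_zero, add_zero]
      linarith
    | succ k ih =>
      obtain ⟨Q, hQ, h⟩ := ih
      refine ⟨(i + 2 * k + 4) ::ₘ Q, by simp [hQ], fun w hw => ?_⟩
      have := hw (i + 2 * k + 2)
      rw [Multiset.map_cons, Multiset.sum_cons, h w hw,
        show i + 2 * (k + 1) + 4 = i + 2 * k + 2 + 4 by ring,
        show i + 2 * (k + 1) + 2 = i + 2 * k + 2 + 2 by ring]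
      linarith
  obtain ⟨Q, hQ, h⟩ := key k
  refine ⟨(i + 2) ::ₘ (i + 2 * k + 2) ::ₘ Q, by simp [hQ], fun w hw => ?_, fun w hw => ?_⟩
  all_goals
    rw [Multiset.map_cons, Multiset.sum_cons, Multiset.map_cons, Multiset.sum_cons, h w]
    · ring
    · intro j
      linarith [hw j, hw (j + 1), hw (j + 2)]

theorem exists_concentration_odd (i k : ℕ) : ∃ P : Multiset ℕ, P.card = k + 2 ∧
    (∀ w, IsBackward w → (P.map w).sum = w i + w (i + 2 * k + 3)) ∧
    ∀ w, IsForward w → (P.map w).sum = w (i + 2 * k + 3) - w i := by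
  have key : ∀ k, ∃ Q : Multiset ℕ, Q.card = k + 1 ∧
      (∀ w, IsBackward w → (Q.map w).sum = w i - w (i + 2 * k + 2)) ∧
      ∀ w, IsForward w → (Q.map w).sum = w (i + 2 * k + 2) - w i := by
    intro k
    induction k with
    | zero =>
      refine ⟨{i + 1}, rfl, fun w hw => ?_, fun w hw => ?_⟩
      all_goals
        have := hw i
        simp only [Multiset.map_singleton, Multiset.sum_singleton, mul_zero, add_zero]
        linarith
    | succ k ih =>
      obtain ⟨Q, hQ, h, h'⟩ := ih
      refine ⟨(i + 2 * k + 3) ::ₘ Q, by simp [hQ], fun w hw => ?_, fun w hw => ?_⟩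
      · have := hw (i + 2 * k + 2)
        rw [Multiset.map_cons, Multiset.sum_cons, h w hw,
          show i + 2 * (k + 1) + 2 = i + 2 * k + 2 + 2 by ring]
        linarith
      · have := hw (i + 2 * k + 2)
        rw [Multiset.map_cons, Multiset.sum_cons, h' w hw,
          show i + 2 * (k + 1) + 2 = i + 2 * k + 2 + 2 by ring]
        linarith
  obtain ⟨Q, hQ, h, h'⟩ := key k
  refine ⟨(i + 2 * k + 1) ::ₘ Q, by simp [hQ], fun w hw => ?_, fun w hw => ?_⟩
  · have := hw (i + 2 * k + 1)
    rw [Multiset.map_cons, Multiset.sum_cons, h w hw]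
    linarith
  · have := hw (i + 2 * k + 1)
    rw [Multiset.map_cons, Multiset.sum_cons, h' w hw]
    linarith

theorem exists_concentration {i j : ℕ} (hij : i + 3 ≤ j) : ∃ P : Multiset ℕ, 2 ≤ P.card ∧
    (∀ w, IsBackward w → (P.map w).sum = w i + w j) ∧
    (∀ w, IsForward w → (∀ n, 0 ≤ w n) → (P.map w).sum ≤ w i + w j) ∧
    ∀ w, IsForward w → (∀ n, 1 ≤ w n) → (P.map w).sum - P.card < w i + w j - 2 := by
  obtain ⟨k, rfl | rfl⟩ : ∃ k, j = i + 2 * k + 4 ∨ j = i + 2 * k + 3 :=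
    ⟨(j - i - 3) / 2, by omega⟩
  · obtain ⟨P, hP, h, h'⟩ := exists_concentration_even i k
    refine ⟨P, by omega, h, fun w hw _ => (h' w hw).le, fun w hw _ => ?_⟩
    rw [h' w hw, hP]
    push_cast
    linarith
  · obtain ⟨P, hP, h, h'⟩ := exists_concentration_odd i k
    refine ⟨P, by omega, h, fun w hw h0 => ?_, fun w hw h1 => ?_⟩
    · rw [h' w hw]
      linarith [h0 i]
    · rw [h' w hw, hP]
      push_cast
      linarith [h1 i]

theorem exists_window_of_forall_le {M : Multiset ℕ} {i : ℕ} (hi : i ∈ M)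
    (hM : ∀ x ∈ M, i ≤ x ∧ x ≤ i + 2) :
    ∃ R, windowSize R = M.card ∧ ∀ w, windowSum w R = (M.map w).sum := by
  have hM' : M = Multiset.replicate (M.count i) i + Multiset.replicate (M.count (i + 1)) (i + 1) +
      Multiset.replicate (M.count (i + 2)) (i + 2) := by
    ext x
    simp only [Multiset.count_add, Multiset.count_replicate]
    by_cases hx : x ∈ M
    · obtain ⟨h1, h2⟩ := hM x hx
      obtain rfl | rfl | rfl : x = i ∨ x = i + 1 ∨ x = i + 2 := by omega
      all_goals simp
    · rw [Multiset.count_eq_zero_of_notMem hx]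
      split_ifs <;> simp_all
  obtain ⟨a, ha⟩ := Nat.exists_eq_add_of_lt (Multiset.count_pos.2 hi)
  refine ⟨(i, a, M.count (i + 1), M.count (i + 2)), ?_, fun w => ?_⟩
  · conv_rhs => rw [hM']
    simp only [windowSize, Multiset.card_add, Multiset.card_replicate]
    omega
  · conv_rhs => rw [hM']
    simp [windowSum, ha]
    ring

theorem isForward_fib : IsForward fun j => (Nat.fib (j + 1) : ℤ) := fun j => by
  have : Nat.fib (j + 1 + 2) = Nat.fib (j + 1) + Nat.fib (j + 1 + 1) := Nat.fib_add_two
  simp only [show j + 2 + 1 = j + 1 + 2 by ring, this]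
  push_cast
  ring

theorem one_le_fib (j : ℕ) : (1 : ℤ) ≤ Nat.fib (j + 1) := by
  exact_mod_cast Nat.fib_pos.2 j.succ_pos

theorem card_le_sum_fib (M : Multiset ℕ) :
    (M.card : ℤ) ≤ (M.map fun j => (Nat.fib (j + 1) : ℤ)).sum := by
  induction M using Multiset.induction with
  | empty => simp
  | cons a M ih =>
    have := one_le_fib a
    simp only [Multiset.card_cons, Multiset.map_cons, Multiset.sum_cons]
    push_cast
    linarith

theorem exists_window (M : Multiset ℕ) (hM : M ≠ 0) :
    ∃ R, M.card ≤ windowSize R ∧ (∀ w, IsBackward w → windowSum w R = (M.map w).sum) ∧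
      ∀ w, IsForward w → (∀ n, 0 ≤ w n) → windowSum w R ≤ (M.map w).sum := by
  induction hn : ((M.map fun j => (Nat.fib (j + 1) : ℤ)).sum - M.card).toNat
    using Nat.strong_induction_on generalizing M with
  | _ n ih =>
  subst hn
  by_cases hgap : ∃ i ∈ M, ∃ j ∈ M, i + 3 ≤ j
  · obtain ⟨i, hi, j, hj, hij⟩ := hgap
    obtain ⟨M, rfl⟩ := Multiset.exists_cons_of_mem hi
    obtain ⟨M, rfl⟩ := Multiset.exists_cons_of_mem
      ((Multiset.mem_cons.1 hj).resolve_left (by omega))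
    obtain ⟨P, hP, hb, hf, hlt⟩ := exists_concentration hij
    have hne : P + M ≠ 0 := fun h => by
      have := congrArg Multiset.card h
      simp only [Multiset.card_add, Multiset.card_zero] at this
      omega
    obtain ⟨R, hR, hRb, hRf⟩ := ih _ (by
      have h1 := hlt _ isForward_fib one_le_fib
      have h2 := card_le_sum_fib (P + M)
      simp only [Multiset.card_cons, Multiset.map_cons, Multiset.sum_cons, Multiset.map_add,
        Multiset.sum_add, Multiset.card_add] at h1 h2 ⊢
      push_cast at h1 h2 ⊢
      omega) (P + M) hne rfl
    refine ⟨R, ?_, fun w hw => ?_, fun w hw h0 => ?_⟩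
    · simp only [Multiset.card_cons, Multiset.card_add] at hR ⊢
      omega
    · rw [hRb w hw, Multiset.map_add, Multiset.sum_add, hb w hw]
      simp only [Multiset.map_cons, Multiset.sum_cons]
      ring
    · have h1 := hRf w hw h0
      have h2 := hf w hw h0
      simp only [Multiset.map_cons, Multiset.sum_cons, Multiset.map_add, Multiset.sum_add] at h1 ⊢
      linarith
  · push Not at hgap
    have hex : ∃ i, i ∈ M := Multiset.exists_mem_of_ne_zero hM
    classical
    obtain ⟨R, hR, h⟩ := exists_window_of_forall_le (Nat.find_spec hex) fun x hx =>
      ⟨Nat.find_min' hex hx, by have := hgap _ (Nat.find_spec hex) x hx; omega⟩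
    exact ⟨R, hR.ge, fun w _ => h w, fun w _ _ => (h w).le⟩

theorem exists_monotone_map_univ {s : ℕ} {M : Multiset ℕ} (hM : M.card = s) :
    ∃ ι : Fin s → ℕ, Monotone ι ∧ Finset.univ.val.map ι = M := by
  subst hM
  have hlen : (M.sort (· ≤ ·)).length = M.card := by simp
  refine ⟨fun k => (M.sort (· ≤ ·)).get (k.cast hlen.symm), fun k l hkl => ?_, ?_⟩
  · exact (Multiset.pairwise_sort M (· ≤ ·)).sortedLE.monotone_get hkl
  · conv_rhs => rw [← Multiset.sort_eq M (· ≤ ·)]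
    rw [Fin.univ_val_map]
    congr 1
    apply List.ext_get <;> simp

theorem exists_monotone_sum_eq_windowSum (R : ℕ × ℕ × ℕ × ℕ) :
    ∃ ι : Fin (windowSize R) → ℕ, Monotone ι ∧ ∀ w, ∑ k, w (ι k) = windowSum w R := by
  obtain ⟨i, a, b, c⟩ := R
  obtain ⟨ι, hι, h⟩ := exists_monotone_map_univ (s := windowSize (i, a, b, c))
    (M := Multiset.replicate (a + 1) i + Multiset.replicate b (i + 1) +
      Multiset.replicate c (i + 2)) (by simp [windowSize]; omega)
  refine ⟨ι, hι, fun w => ?_⟩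
  have : ∑ k, w (ι k) = ((Finset.univ.val.map ι).map w).sum := by
    rw [Multiset.map_map]; rfl
  rw [this, h]
  simp [windowSum]
  ring

/-! ### Counting the maximal windows -/

/-- The windows of cardinality `s` whose `u`-sum and `v`-sum are bounded by `d₁` and `d₂`. -/
def windowSet (u v : ℕ → ℤ) (d₁ d₂ s : ℕ) : Set (ℕ × ℕ × ℕ × ℕ) :=
  {R | windowSize R = s ∧ windowSum u R ≤ d₁ ∧ windowSum v R ≤ d₂}

section Count

variable {u v : ℕ → ℤ} (hu : IsForward u) (hv : IsForward v) (hu0 : u 0 = 1) (hu1 : u 1 = 0)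
  (hv0 : v 0 = 0) (hv1 : v 1 = 1)

theorem IsForward.nonneg {w : ℕ → ℤ} (hw : IsForward w) (h0 : 0 ≤ w 0) (h1 : 0 ≤ w 1) (n : ℕ) :
    0 ≤ w n := by
  suffices 0 ≤ w n ∧ 0 ≤ w (n + 1) from this.1
  induction n with
  | zero => exact ⟨h0, h1⟩
  | succ n ih => exact ⟨ih.2, by have := hw n; linarith [ih.1, ih.2]⟩

theorem injective_expand : Function.Injective expand := by
  rintro ⟨i, _ | a, b, c⟩ ⟨i', _ | a', b', c'⟩ <;> grind [expand]

theorem mem_range_expand_iff (R : ℕ × ℕ × ℕ × ℕ) :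
    R ∈ Set.range expand ↔ R.2.2.1 ≠ 0 ∧ ¬ (R.1 = 0 ∧ R.2.2.2 = 0) := by
  constructor
  · rintro ⟨⟨i, _ | a, b, c⟩, rfl⟩ <;> simp [expand]
  · obtain ⟨i, a, _ | b, _ | c⟩ := R
    · simp
    · simp
    · rintro ⟨-, h⟩
      obtain ⟨i, rfl⟩ := Nat.exists_eq_succ_of_ne_zero (n := i) (by simpa using h)
      exact ⟨(i, 0, a, b), rfl⟩
    · exact fun _ => ⟨(i, a + 1, b, c), rfl⟩

theorem injOn_merge : Set.InjOn merge {R | R.2.2.1 ≠ 0} := by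
  rintro ⟨i, _ | a, _ | _ | b, c⟩ h ⟨i', _ | a', _ | _ | b', c'⟩ h' <;>
    grind [merge]

/-- Windows contained in `{0, 1}`. -/
def initialWindows : Set (ℕ × ℕ × ℕ × ℕ) :=
  {R | R.2.2.2 = 0 ∧ (R.1 = 0 ∨ R.1 = 1 ∧ R.2.2.1 = 0)}

theorem image_merge : merge '' {R | R.2.2.1 ≠ 0} = initialWindowsᶜ := by
  ext R
  constructor
  · rintro ⟨⟨i, _ | a, _ | _ | b, c⟩, h, rfl⟩ <;> simp_all [merge, initialWindows]
  · obtain ⟨_ | _ | i, a, _ | b, _ | c⟩ := R <;> intro h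
    all_goals first
      | exact ⟨(_, a + 1, _ + 1, c), by simp, rfl⟩
      | exact ⟨(_, 0, a + 2, b), by simp, rfl⟩
      | exact ⟨(i, 0, 1, a), by simp, rfl⟩
      | simp [initialWindows] at h

theorem windowSize_merge {R} (hR : R.2.2.1 ≠ 0) : windowSize (merge R) + 1 = windowSize R := by
  obtain ⟨i, _ | a, _ | _ | b, c⟩ := R <;> simp_all only [merge, windowSize] <;> omega

include hu0 hu1 hv0 hv1

theorem ncard_windowSet_inter_initialWindows (d₁ d₂ s : ℕ) :
    (windowSet u v d₁ d₂ (s + 1) ∩ initialWindows).ncard =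
      (Finset.Icc (s + 1 - d₂) (min d₁ (s + 1))).card := by
  rw [← Set.ncard_coe_finset]
  symm
  refine Set.ncard_congr
    (fun p _ => if p = 0 then (1, s, 0, 0) else (0, p - 1, s + 1 - p, 0)) ?_ ?_ ?_
  · intro p hp
    simp only [Finset.coe_Icc, Set.mem_Icc] at hp
    split_ifs with h
    · simp [windowSet, initialWindows, windowSize, windowSum, hu1, hv1]
      omega
    · simp [windowSet, initialWindows, windowSize, windowSum, hu0, hv0, hu1, hv1]
      omega
  · intro p q hp hq h
    simp only [Finset.coe_Icc, Set.mem_Icc] at hp hq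
    split_ifs at h <;> simp only [Prod.mk.injEq] at h <;> omega
  · rintro ⟨i, a, b, c⟩ ⟨⟨h, h1, h2⟩, h3, h4⟩
    obtain rfl : c = 0 := h3
    obtain h4 | ⟨h4, h5⟩ := h4
    · obtain rfl : i = 0 := h4
      simp [windowSum, windowSize, hu0, hv0, hu1, hv1] at h h1 h2
      refine ⟨a + 1, by simp; omega, ?_⟩
      simp
      omega
    · obtain rfl : i = 1 := h4
      obtain rfl : b = 0 := h5
      simp [windowSum, windowSize, hu1, hv1] at h h1 h2
      refine ⟨0, by simp; omega, ?_⟩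
      simp
      omega

theorem ncard_windowSet_sep (d₁ d₂ s : ℕ) :
    {R ∈ windowSet u v d₁ d₂ (s + 1) | R.2.2.1 ≠ 0 ∧ R.1 = 0 ∧ R.2.2.2 = 0}.ncard =
      (Finset.Icc (max 1 (s + 1 - d₂)) (min d₁ s)).card := by
  rw [← Set.ncard_coe_finset]
  symm
  refine Set.ncard_congr (fun p _ => (0, p - 1, s + 1 - p, 0)) ?_ ?_ ?_
  · intro p hp
    simp only [Finset.coe_Icc, Set.mem_Icc] at hp
    simp [windowSet, windowSize, windowSum, hu0, hv0, hu1, hv1]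
    omega
  · intro p q hp hq h
    simp only [Finset.coe_Icc, Set.mem_Icc] at hp hq
    simp only [Prod.mk.injEq] at h
    omega
  · rintro ⟨i, a, b, c⟩ ⟨⟨h, h1, h2⟩, h3, h4, h5⟩
    obtain rfl : c = 0 := h5
    obtain rfl : i = 0 := h4
    simp [windowSum, windowSize, hu0, hv0, hu1, hv1] at h h1 h2 h3
    refine ⟨a + 1, by simp; omega, ?_⟩
    simp
    omega

include hu hv

theorem finite_windowSet (d₁ d₂ s : ℕ) : (windowSet u v d₁ d₂ s).Finite := by
  refine (Set.finite_Iic (d₁ + d₂, s, s, s)).subset ?_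
  rintro ⟨i, a, b, c⟩ ⟨h, h1, h2⟩
  have hu' := hu.nonneg (by simp [hu0]) hu1.ge
  have hv' := hv.nonneg hv0.ge (by simp [hv1])
  have key : ∀ n : ℕ, (n : ℤ) ≤ u n + v n ∧ 1 ≤ u n + v n ∧ (n + 1 : ℤ) ≤ u (n + 1) + v (n + 1) := by
    intro n
    induction n with
    | zero => simp [*]
    | succ n ih =>
      have := hu n
      have := hv n
      push_cast
      refine ⟨ih.2.2, ?_, ?_⟩
      · linarith
      · rw [show n + 1 + 1 = n + 2 from rfl]
        linarith
  have hi : (i : ℤ) ≤ d₁ + d₂ := by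
    simp only [windowSum] at h1 h2
    have e1 : 0 ≤ (a : ℤ) * u i := mul_nonneg (by positivity) (hu' _)
    have e2 : 0 ≤ (b : ℤ) * u (i + 1) := mul_nonneg (by positivity) (hu' _)
    have e3 : 0 ≤ (c : ℤ) * u (i + 2) := mul_nonneg (by positivity) (hu' _)
    have e4 : 0 ≤ (a : ℤ) * v i := mul_nonneg (by positivity) (hv' _)
    have e5 : 0 ≤ (b : ℤ) * v (i + 1) := mul_nonneg (by positivity) (hv' _)
    have e6 : 0 ≤ (c : ℤ) * v (i + 2) := mul_nonneg (by positivity) (hv' _)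
    linarith [(key i).1]
  simp only [windowSize] at h
  simp only [Set.mem_Iic, Prod.mk_le_mk]
  omega

theorem ncard_windowSet_diff (d₁ d₂ s : ℕ) :
    {R ∈ windowSet u v d₁ d₂ s | expand R ∉ windowSet u v d₁ d₂ (s + 1)}.ncard =
      (windowSet u v d₁ d₂ s ∩ initialWindows).ncard +
      {R ∈ windowSet u v d₁ d₂ (s + 1) | R.2.2.1 ≠ 0 ∧ R.1 = 0 ∧ R.2.2.2 = 0}.ncard := by
  have hu' := hu.nonneg (by simp [hu0]) hu1.ge
  have hv' := hv.nonneg hv0.ge (by simp [hv1])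
  have fin := finite_windowSet hu hv hu0 hu1 hv0 hv1 d₁ d₂
  set S := windowSet u v d₁ d₂ with hS
  have h1 : {R ∈ S s | expand R ∈ S (s + 1)}.ncard =
      {R ∈ S (s + 1) | R.2.2.1 ≠ 0 ∧ ¬ (R.1 = 0 ∧ R.2.2.2 = 0)}.ncard := by
    rw [← Set.ncard_image_of_injective _ injective_expand]
    congr 1
    ext R
    rw [Set.mem_ofPred_eq, ← mem_range_expand_iff]
    constructor
    · rintro ⟨R, ⟨-, h⟩, rfl⟩
      exact ⟨h, R, rfl⟩
    · rintro ⟨h, R, rfl⟩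
      refine ⟨R, ⟨⟨?_, ?_, ?_⟩, h⟩, rfl⟩
      · have := h.1
        rw [windowSize_expand] at this
        omega
      · exact (windowSum_le_windowSum_expand hu hu' R).trans h.2.1
      · exact (windowSum_le_windowSum_expand hv hv' R).trans h.2.2
  have h2 : {R ∈ S (s + 1) | R.2.2.1 ≠ 0}.ncard = (S s \ initialWindows).ncard := by
    rw [← Set.InjOn.ncard_image (injOn_merge.mono fun R hR => hR.2)]
    congr 1
    rw [Set.sdiff_eq, ← image_merge]
    have hmem : ∀ R : ℕ × ℕ × ℕ × ℕ, R.2.2.1 ≠ 0 → (merge R ∈ S s ↔ R ∈ S (s + 1)) := by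
      intro R hR
      have := windowSize_merge hR
      simp only [hS, windowSet, Set.mem_ofPred_eq, windowSum_merge hu, windowSum_merge hv]
      rw [← this, Nat.add_right_cancel_iff]
    ext R
    constructor
    · rintro ⟨R, ⟨h, h'⟩, rfl⟩
      exact ⟨(hmem R h').2 h, R, h', rfl⟩
    · rintro ⟨h, R, h', rfl⟩
      exact ⟨R, ⟨(hmem R h').1 h, h'⟩, rfl⟩
  have h3 := Set.ncard_inter_add_ncard_sdiff_eq_ncard (S s) {R | expand R ∈ S (s + 1)} (fin s)
  have h4 := Set.ncard_inter_add_ncard_sdiff_eq_ncard (S s) initialWindows (fin s)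
  have h5 := Set.ncard_inter_add_ncard_sdiff_eq_ncard {R ∈ S (s + 1) | R.2.2.1 ≠ 0}
    {R | R.1 = 0 ∧ R.2.2.2 = 0} ((fin (s + 1)).subset fun R hR => hR.1)
  have e3 : S s \ {R | expand R ∈ S (s + 1)} = {R ∈ S s | expand R ∉ S (s + 1)} := rfl
  have e3' : S s ∩ {R | expand R ∈ S (s + 1)} = {R ∈ S s | expand R ∈ S (s + 1)} := rfl
  have e5 : {R ∈ S (s + 1) | R.2.2.1 ≠ 0} ∩ {R | R.1 = 0 ∧ R.2.2.2 = 0} =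
      {R ∈ S (s + 1) | R.2.2.1 ≠ 0 ∧ R.1 = 0 ∧ R.2.2.2 = 0} := by
    ext; simp only [Set.mem_inter_iff, Set.mem_ofPred_eq, and_assoc]
  have e5' : {R ∈ S (s + 1) | R.2.2.1 ≠ 0} \ {R | R.1 = 0 ∧ R.2.2.2 = 0} =
      {R ∈ S (s + 1) | R.2.2.1 ≠ 0 ∧ ¬ (R.1 = 0 ∧ R.2.2.2 = 0)} := by
    ext; simp only [Set.mem_sdiff, Set.mem_ofPred_eq, and_assoc]
  rw [e3, e3'] at h3
  rw [e5, e5'] at h5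
  omega

end Count

/-! ### Windows with prescribed sum -/

section Fibonacci

variable {f : ℤ → ℤ} (hf0 : f 0 = 1) (hf1 : f 1 = 1) (hrec : ∀ i : ℤ, f (i + 2) = f (i + 1) + f i)

include hrec

theorem isBackward_neg (e : ℤ) : IsBackward fun j => f (-j - e) := fun j => by
  have := hrec (-j - e - 2)
  ring_nf at this
  push_cast
  ring_nf
  linarith

theorem isForward_sub (e : ℤ) : IsForward fun j => f (j - e) := fun j => by
  have := hrec (j - e)
  ring_nf at this
  push_cast
  ring_nf
  linarith

include hf0 hf1

theorem fibonacci_mul_add_mul (j : ℕ) (e : ℤ) :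
    f (-j) * f (j + e) + f (-j - 1) * f (j + e - 1) = f e := by
  induction j with
  | zero =>
    have := hrec (-1)
    simp [hf0, hf1] at this
    simp [hf0, this]
  | succ j ih =>
    have h1 := hrec (j + e - 1)
    have h2 := hrec (-j - 2)
    ring_nf at h1 h2 ih
    push_cast
    ring_nf
    rw [h1]
    linear_combination ih - f (j + e) * h2

/-- The `n`-th coordinate functional, evaluated on the vector sum of a window. -/
theorem windowSum_mul_add_windowSum_mul (i a b c : ℕ) (e : ℤ) :
    windowSum (fun j => f (-j)) (i, a, b, c) * f (i + e) +
      windowSum (fun j => f (-j - 1)) (i, a, b, c) * f (i + e - 1) =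
      (a + 1) * f e + b * f (e - 1) + c * f (e - 2) := by
  have h0 := fibonacci_mul_add_mul hf0 hf1 hrec i e
  have h1 := fibonacci_mul_add_mul hf0 hf1 hrec (i + 1) (e - 1)
  have h2 := fibonacci_mul_add_mul hf0 hf1 hrec (i + 2) (e - 2)
  push_cast at h1 h2
  rw [show (i : ℤ) + 1 + (e - 1) = i + e by ring] at h1
  rw [show (i : ℤ) + 2 + (e - 2) = i + e by ring] at h2
  simp only [windowSum]
  push_cast
  linear_combination (a + 1) * h0 + b * h1 + c * h2

theorem fibonacci_neg_values : f (-1) = 0 ∧ f (-2) = 1 := by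
  have h1 := hrec (-1)
  have h2 := hrec (-2)
  norm_num [hf0, hf1] at h1 h2
  constructor <;> linarith

theorem windowSum_ne_zero (R) :
    ¬ (windowSum (fun j => f (-j)) R = 0 ∧ windowSum (fun j => f (-j - 1)) R = 0) := by
  rintro ⟨h1, h2⟩
  obtain ⟨i, a, b, c⟩ := R
  have := windowSum_mul_add_windowSum_mul hf0 hf1 hrec i a b c 0
  obtain ⟨e1, e2⟩ := fibonacci_neg_values hf0 hf1 hrec
  simp [h1, h2, hf0, e1, e2] at this
  omega

theorem windowSum_injective {R R'}
    (h1 : windowSum (fun j => f (-j)) R = windowSum (fun j => f (-j)) R')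
    (h2 : windowSum (fun j => f (-j - 1)) R = windowSum (fun j => f (-j - 1)) R')
    (hs : windowSize R = windowSize R') : R = R' := by
  wlog hle : R.1 ≤ R'.1 generalizing R R'
  · exact (this h1.symm h2.symm hs.symm (by omega)).symm
  obtain ⟨i, a, b, c⟩ := R
  obtain ⟨i', a', b', c'⟩ := R'
  obtain ⟨e1, e2⟩ := fibonacci_neg_values hf0 hf1 hrec
  have k0 := windowSum_mul_add_windowSum_mul hf0 hf1 hrec i a b c 0
  have k1 := windowSum_mul_add_windowSum_mul hf0 hf1 hrec i a b c 1
  have k0' := windowSum_mul_add_windowSum_mul hf0 hf1 hrec i' a' b' c' 0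
  have k1' := windowSum_mul_add_windowSum_mul hf0 hf1 hrec i' a' b' c' 1
  rw [← h1, ← h2] at k0' k1'
  set m := windowSum (fun j => f (-j)) (i, a, b, c)
  set n := windowSum (fun j => f (-j - 1)) (i, a, b, c)
  norm_num [hf0, hf1, e1, e2] at k0 k1 k0' k1'
  simp only [windowSize] at hs
  obtain ⟨k, rfl⟩ := Nat.exists_eq_add_of_le hle
  cases k with
  | zero =>
    simp only [add_zero] at k0' k1'
    simp only [Prod.mk.injEq]
    omega
  | succ k =>
    exfalso
    obtain ⟨X, hX⟩ : ∃ X : ℤ → ℤ, ∀ e, X e = m * f e + n * f (e - 1) := ⟨_, fun _ => rfl⟩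
    have hXrec : ∀ e, X (e + 2) = X (e + 1) + X e := fun e => by
      have r1 := hrec e
      have r2 := hrec (e - 1)
      rw [hX, hX, hX, r1, show e + 2 - 1 = e - 1 + 2 by ring, r2]
      ring_nf
    have hXi : X i = a + 1 + c := (hX i).trans k0
    have hXi' : X (i + 1) = a + 1 + b := by rw [hX, add_sub_cancel_right, k1]
    have hmono : ∀ l : ℕ, (a : ℤ) + 1 + b ≤ X (i + l + 1) ∧
        (a : ℤ) + 1 + c + (a + 1 + b) ≤ X (i + l + 2) := by
      intro l
      induction l with
      | zero =>
        have := hXrec i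
        simp only [Nat.cast_zero, add_zero]
        constructor <;> linarith
      | succ l ih =>
        have := hXrec (i + l + 1)
        rw [show (i : ℤ) + l + 1 + 1 = i + l + 2 by ring] at this
        rw [show (i : ℤ) + (l + 1 : ℕ) + 1 = i + l + 2 by push_cast; ring,
          show (i : ℤ) + (l + 1 : ℕ) + 2 = i + l + 1 + 2 by push_cast; ring]
        constructor <;> linarith [ih.1, ih.2]
    have hlast : X (i + k + 2) = a' + 1 + b' := by
      rw [← k1', hX]
      push_cast
      ring_nf
    have := (hmono k).2
    omega

end Fibonacci

theorem stmt_13 (f : ℤ → ℤ) (hf0 : f 0 = 1) (hf1 : f 1 = 1)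
    (hrec : ∀ i : ℤ, f (i + 2) = f (i + 1) + f i)
    (d₁ d₂ : ℕ)
    (Rep : ℕ → ℤ × ℤ → Prop)
    (hRep : ∀ (s : ℕ) (p : ℤ × ℤ), Rep s p ↔ ∃ ι : Fin s → ℕ, Monotone ι ∧
      p.1 = ∑ k : Fin s, f (-(ι k : ℤ)) ∧
      p.2 = ∑ k : Fin s, f (-(ι k : ℤ) - 1) ∧
      ∑ k : Fin s, f ((ι k : ℤ) - 2) ≤ (d₁ : ℤ) ∧
      ∑ k : Fin s, f ((ι k : ℤ) - 1) ≤ (d₂ : ℤ))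
    (χ : ℕ → ℕ)
    (hχ : ∀ s : ℕ, χ s = {p : ℤ × ℤ | Rep s p ∧ ∀ t : ℕ, Rep t p → t ≤ s}.ncard) :
    ∀ s : ℕ, (s ≤ d₁ + d₂ → χ s = 2 * min (min d₁ d₂) (min s (d₁ + d₂ - s)) + 1) ∧
      (d₁ + d₂ < s → χ s = 0) := by
  obtain ⟨e1, e2⟩ := fibonacci_neg_values hf0 hf1 hrec
  set x : ℕ → ℤ := fun j => f (-j) with hx
  set y : ℕ → ℤ := fun j => f (-j - 1) with hy
  set u : ℕ → ℤ := fun j => f (j - 2) with hu_def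
  set v : ℕ → ℤ := fun j => f (j - 1) with hv_def
  have hxb : IsBackward x := by simpa using isBackward_neg hrec 0
  have hyb : IsBackward y := isBackward_neg hrec 1
  have hu : IsForward u := isForward_sub hrec 2
  have hv : IsForward v := isForward_sub hrec 1
  have hu0 : u 0 = 1 := by simp [hu_def, e2]
  have hu1 : u 1 = 0 := by norm_num [hu_def, e1]
  have hv0 : v 0 = 0 := by simp [hv_def, e1]
  have hv1 : v 1 = 1 := by simp [hv_def, hf0]
  have hu' := hu.nonneg (by simp [hu0]) hu1.ge
  have hv' := hv.nonneg hv0.ge (by simp [hv1])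
  set S := windowSet u v d₁ d₂ with hS
  let pt : ℕ × ℕ × ℕ × ℕ → ℤ × ℤ := fun R => (windowSum x R, windowSum y R)
  have rep_of_mem : ∀ {s R}, R ∈ S s → Rep s (pt R) := by
    rintro _ R ⟨rfl, h1, h2⟩
    obtain ⟨ι, hι, h⟩ := exists_monotone_sum_eq_windowSum R
    exact (hRep _ _).2 ⟨ι, hι, (h x).symm, (h y).symm, (h u).trans_le h1, (h v).trans_le h2⟩
  have mem_of_rep : ∀ {t p}, Rep (t + 1) p → ∃ s ≥ t + 1, ∃ R ∈ S s, pt R = p := by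
    intro t p hp
    obtain ⟨ι, -, h1, h2, h3, h4⟩ := (hRep _ _).1 hp
    obtain ⟨R, hR, hb, hf⟩ := exists_window (Finset.univ.val.map ι) fun h => by
      simpa using congrArg Multiset.card h
    have hsum : ∀ w : ℕ → ℤ, ((Finset.univ.val.map ι).map w).sum = ∑ k, w (ι k) := fun w => by
      rw [Multiset.map_map]; rfl
    refine ⟨windowSize R, by simpa using hR, R, ⟨rfl, ?_, ?_⟩, Prod.ext ?_ ?_⟩
    · exact (hf u hu hu').trans ((hsum u).trans_le h3)
    · exact (hf v hv hv').trans ((hsum v).trans_le h4)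
    · exact (hb x hxb).trans ((hsum x).trans h1.symm)
    · exact (hb y hyb).trans ((hsum y).trans h2.symm)
  have pt_inj : ∀ {R R'}, pt R = pt R' → windowSize R = windowSize R' → R = R' := fun h h' =>
    windowSum_injective hf0 hf1 hrec (congrArg Prod.fst h) (congrArg Prod.snd h) h'
  have expand_mem : ∀ {s t R R'}, R ∈ S s → R' ∈ S t → pt R = pt R' → s < t →
      expand R ∈ S (s + 1) := by
    rintro _ _ R R' ⟨rfl, -, -⟩ ⟨rfl, h1, h2⟩ hpt hlt
    obtain ⟨k, hk⟩ := Nat.exists_eq_add_of_lt hlt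
    have heq : expand^[k] (expand R) = R' := by
      apply pt_inj
      · rw [← hpt]
        simp only [pt, windowSum_iterate_expand hxb, windowSum_iterate_expand hyb,
          windowSum_expand_of_isBackward hxb, windowSum_expand_of_isBackward hyb]
      · rw [windowSize_iterate_expand, windowSize_expand, hk]
        ring
    subst heq
    exact ⟨windowSize_expand R, (windowSum_le_windowSum_iterate_expand hu hu' _ _).trans h1,
      (windowSum_le_windowSum_iterate_expand hv hv' _ _).trans h2⟩
  intro s
  rw [hχ]
  cases s with
  | zero =>
    have : {p : ℤ × ℤ | Rep 0 p ∧ ∀ t : ℕ, Rep t p → t ≤ 0} = {(0, 0)} := by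
      ext p
      have h0 : Rep 0 p ↔ p = (0, 0) := by
        rw [hRep]
        simp [Prod.ext_iff, Subsingleton.monotone]
      simp only [Set.mem_ofPred_eq, h0, Set.mem_singleton_iff, and_iff_left_iff_imp]
      rintro rfl t ht
      cases t with
      | zero => rfl
      | succ t =>
        obtain ⟨_, _, R, _, h⟩ := mem_of_rep ht
        exact (windowSum_ne_zero hf0 hf1 hrec R
          ⟨congrArg Prod.fst h, congrArg Prod.snd h⟩).elim
    rw [this, Set.ncard_singleton]
    omega
  | succ s =>
    have hset : {p : ℤ × ℤ | Rep (s + 1) p ∧ ∀ t : ℕ, Rep t p → t ≤ s + 1} =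
        pt '' {R ∈ S (s + 1) | expand R ∉ S (s + 1 + 1)} := by
      ext p
      constructor
      · rintro ⟨hp, hmax⟩
        obtain ⟨t, ht, R, hR, rfl⟩ := mem_of_rep hp
        obtain rfl : t = s + 1 := le_antisymm (hmax t (rep_of_mem hR)) ht
        refine ⟨R, ⟨hR, fun h => ?_⟩, rfl⟩
        have hpt : pt (expand R) = pt R := by
          simp only [pt, windowSum_expand_of_isBackward hxb, windowSum_expand_of_isBackward hyb]
        have := hmax _ (hpt ▸ rep_of_mem h)
        omega
      · rintro ⟨R, ⟨hR, hE⟩, rfl⟩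
        refine ⟨rep_of_mem hR, fun t ht => ?_⟩
        by_contra! hlt
        obtain ⟨t, rfl⟩ := Nat.exists_eq_add_of_lt hlt
        obtain ⟨t', ht', R', hR', hpt⟩ := mem_of_rep ht
        exact hE (expand_mem hR hR' hpt.symm (by omega))
    have hinj : Set.InjOn pt {R ∈ S (s + 1) | expand R ∉ S (s + 1 + 1)} := fun R hR R' hR' h =>
      pt_inj h (hR.1.1.trans hR'.1.1.symm)
    rw [hset, hinj.ncard_image, hS,
      ncard_windowSet_diff hu hv hu0 hu1 hv0 hv1,
      ncard_windowSet_inter_initialWindows hu0 hu1 hv0 hv1,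
      ncard_windowSet_sep hu0 hu1 hv0 hv1, Nat.card_Icc, Nat.card_Icc]
    omega
end

section
/- For all d₁,d₂ ∈ ℕ, Σ_{s=0}^{d₁+d₂} (2·min{d₁, d₂, s, d₁+d₂−s} + 1)·(2s+1) = (d₁+d₂+1)(2d₁d₂+d₁+d₂+1). -/
theorem sum_two_mul_min_add_one (d₁ d₂ : ℕ) :
    ∑ s ∈ Finset.range (d₁ + d₂ + 1), (2 * min (min d₁ d₂) (min s (d₁ + d₂ - s)) + 1)
      = 2 * d₁ * d₂ + d₁ + d₂ + 1 := by
  induction d₁ generalizing d₂ with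
  | zero => simp
  | succ a ih =>
    cases d₂ with
    | zero => simp
    | succ b =>
      rw [show a + 1 + (b + 1) + 1 = a + b + 1 + 1 + 1 by ring, Finset.sum_range_succ,
        Finset.sum_range_succ']
      have shift : ∀ s ∈ Finset.range (a + b + 1),
          2 * min (min (a + 1) (b + 1)) (min (s + 1) (a + 1 + (b + 1) - (s + 1))) + 1
            = (2 * min (min a b) (min s (a + b - s)) + 1) + 2 := by
        intro s hs
        rw [Finset.mem_range] at hs
        omega
      rw [Finset.sum_congr rfl shift, Finset.sum_add_distrib, ih b,
        show a + 1 + (b + 1) - (a + b + 1 + 1) = 0 by omega]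
      simp
      ring

theorem stmt_15 (d₁ d₂ : ℕ) :
    ∑ s ∈ Finset.range (d₁ + d₂ + 1),
        (2 * min (min d₁ d₂) (min s (d₁ + d₂ - s)) + 1) * (2 * s + 1)
      = (d₁ + d₂ + 1) * (2 * d₁ * d₂ + d₁ + d₂ + 1) := by
  have reflect := Finset.sum_range_reflect
    (fun s => (2 * min (min d₁ d₂) (min s (d₁ + d₂ - s)) + 1) * (2 * s + 1)) (d₁ + d₂ + 1)
  have pair : ∀ s ∈ Finset.range (d₁ + d₂ + 1),
      (2 * min (min d₁ d₂) (min (d₁ + d₂ + 1 - 1 - s) (d₁ + d₂ - (d₁ + d₂ + 1 - 1 - s))) + 1)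
          * (2 * (d₁ + d₂ + 1 - 1 - s) + 1)
        + (2 * min (min d₁ d₂) (min s (d₁ + d₂ - s)) + 1) * (2 * s + 1)
      = 2 * (d₁ + d₂ + 1) * (2 * min (min d₁ d₂) (min s (d₁ + d₂ - s)) + 1) := by
    intro s hs
    rw [Finset.mem_range] at hs
    obtain ⟨t, ht⟩ := Nat.exists_eq_add_of_le (Nat.le_of_lt_succ hs)
    rw [ht, show s + t + 1 - 1 - s = t by omega, show s + t - t = s by omega,
      show s + t - s = t by omega, min_comm t s]
    ring
  have total := Finset.sum_congr rfl pair
  rw [Finset.sum_add_distrib, ← Finset.mul_sum, sum_two_mul_min_add_one] at total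
  linarith
end

section
/- Let R = ℚ[X₀,X₁,X₂,X₀*,X₁*,X₂*] and let a₁₁,a₁₂,a₂₁,a₂₂ ∈ ℤ with a₁₁a₂₂ − a₁₂a₂₁ = 1, the matrix M = (aᵢⱼ) neither symmetric nor skew-symmetric. Then the ideal I of R generated by X₀X₂−X₁²−1, X₀*X₂*−(X₁*)²−1, and Φ(X,X*) is a prime ideal of height 3. -/
section

open Polynomial

lemma Polynomial.not_isSquare_C_mul_X_sq_sub_C {K : Type*} [Field K] (h2 : (2 : K) ≠ 0)
    {a b : K} (ha : a ≠ 0) (hb : b ≠ 0) (d : K[X]) : d ^ 2 ≠ C a * X ^ 2 - C b := by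
  intro h
  have hdeg : d.natDegree ≤ 1 := by
    have h1 : (d ^ 2).natDegree ≤ 2 := by
      rw [h]
      compute_degree
    rw [natDegree_pow] at h1
    omega
  obtain ⟨α, β, rfl⟩ := exists_eq_X_add_C_of_natDegree_le_one hdeg
  have e0 : β ^ 2 = -b := by simpa using congrArg (eval 0) h
  have e1 : (α + β) ^ 2 = a - b := by simpa using congrArg (eval 1) h
  have e2 : (-α + β) ^ 2 = a - b := by simpa using congrArg (eval (-1)) h
  have e3 : (2 * 2) * (α * β) = 0 := by linear_combination e1 - e2
  have e4 : α * β = 0 := (mul_eq_zero.mp e3).resolve_left (mul_ne_zero h2 h2)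
  rcases mul_eq_zero.mp e4 with rfl | rfl
  · exact ha (by linear_combination e0 - e1)
  · exact hb (by linear_combination e0)

/-- The affine conic `z₀ z₂ = z₁ ^ 2 + 1`, `p · z = 0` with nonzero discriminant has a generic point:
`z₀` is transcendental and `z₁` is quadratic over `A[z₀]`. -/
lemma exists_generic_conic_point {A : Type} [CommRing A] [IsDomain A] (h2 : (2 : A) ≠ 0)
    (p : Fin 3 → A) (hp : p 2 ≠ 0) (hD : p 1 ^ 2 - 4 * p 0 * p 2 ≠ 0) :
    ∃ (L : Type) (_ : Field L) (g : A →+* L) (z : Fin 3 → L), Function.Injective g ∧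
      g (p 0) * z 0 + g (p 1) * z 1 + g (p 2) * z 2 = 0 ∧ z 0 * z 2 = z 1 ^ 2 + 1 ∧
      ∀ r s : A[X], r.eval₂ g (z 0) + s.eval₂ g (z 0) * z 1 = 0 → r = 0 ∧ s = 0 := by
  let K := FractionRing A
  let F := FractionRing K[X]
  let L := AlgebraicClosure F
  let k : A →+* K := algebraMap A K
  have hk : Function.Injective k := IsFractionRing.injective A K
  let φ : K[X] →+* F := algebraMap K[X] F
  have hφ : Function.Injective φ := IsFractionRing.injective K[X] F
  let ψ : F →+* L := algebraMap F L
  have hψ : Function.Injective ψ := ψ.injective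
  let ρ : A[X] →+* F := φ.comp (mapRingHom k)
  have hρ : Function.Injective ρ := hφ.comp (map_injective k hk)
  let j : A[X] →+* L := ψ.comp ρ
  have hj : Function.Injective j := hψ.comp hρ
  let g : A →+* L := j.comp C
  have hg : Function.Injective g := hj.comp C_injective
  let D := p 1 ^ 2 - 4 * p 0 * p 2
  let δ : A[X] := C D * X ^ 2 - C (4 * p 2 ^ 2)
  have h2L : (2 : L) ≠ 0 := by
    rw [← map_ofNat g 2]
    exact (map_ne_zero_iff g hg).mpr h2
  have hpL : g (p 2) ≠ 0 := (map_ne_zero_iff g hg).mpr hp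
  have h4 : (4 : A) ≠ 0 := by
    have : (4 : A) = 2 * 2 := by norm_num
    rw [this]; exact mul_ne_zero h2 h2
  obtain ⟨s, hs⟩ := IsAlgClosed.exists_pow_nat_eq (j δ) (n := 2) (by norm_num)
  have hsF : ∀ t : F, ψ t ≠ s := by
    intro t ht
    have h1 : t ^ 2 = φ (mapRingHom k δ) := by
      apply hψ
      rw [map_pow, ht, hs]
      rfl
    obtain ⟨d, hd⟩ := IsIntegrallyClosed.exists_algebraMap_eq_of_isIntegral_pow
      (R := K[X]) (K := F) (x := t) (n := 2) (by norm_num) (by rw [h1]; exact isIntegral_algebraMap)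
    have h3 : d ^ 2 = mapRingHom k δ := by
      apply hφ
      rw [map_pow, ← h1]
      exact congrArg (· ^ 2) hd
    refine not_isSquare_C_mul_X_sq_sub_C (K := K) (a := k D) (b := k (4 * p 2 ^ 2)) ?_ ?_ ?_ d ?_
    · rw [← map_ofNat k 2]
      exact (map_ne_zero_iff k hk).mpr h2
    · exact (map_ne_zero_iff k hk).mpr hD
    · exact (map_ne_zero_iff k hk).mpr (mul_ne_zero h4 (pow_ne_zero _ hp))
    · rw [h3]
      simp [δ]
  let u : L := j X
  have hev : ∀ r : A[X], r.eval₂ g u = j r := by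
    intro r
    have : (eval₂RingHom g u) = j := by
      apply ringHom_ext <;> simp [g, u]
    exact congrArg (fun f => f r) this
  have hs' : s ^ 2 = (g (p 1) ^ 2 - 4 * g (p 0) * g (p 2)) * u ^ 2 - 4 * g (p 2) ^ 2 := by
    rw [hs, ← map_ofNat g 4]
    change j δ = (g (p 1) ^ 2 - g 4 * g (p 0) * g (p 2)) * u ^ 2 - g 4 * g (p 2) ^ 2
    have hjC : ∀ a, j (C a) = g a := fun _ => rfl
    simp only [δ, D, map_sub, map_mul, map_pow, hjC, u]
  let v : L := (s - g (p 1) * u) / (2 * g (p 2))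
  have hv : 2 * g (p 2) * v = s - g (p 1) * u := by
    exact mul_div_cancel₀ _ (mul_ne_zero h2L hpL)
  let w : L := -(g (p 0) * u + g (p 1) * v) / g (p 2)
  have hw : g (p 2) * w = -(g (p 0) * u + g (p 1) * v) := by
    exact mul_div_cancel₀ _ hpL
  refine ⟨L, inferInstance, g, ![u, v, w], hg, ?_, ?_, ?_⟩
  · change g (p 0) * u + g (p 1) * v + g (p 2) * w = 0
    rw [hw]; ring
  · change u * w = v ^ 2 + 1
    have h4L : (4 : L) * g (p 2) ^ 2 ≠ 0 := by
      have : (4 : L) = 2 * 2 := by norm_num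
      rw [this]; exact mul_ne_zero (mul_ne_zero h2L h2L) (pow_ne_zero _ hpL)
    apply mul_left_cancel₀ h4L
    linear_combination 4 * g (p 2) * u * hw - hs' -
      (2 * g (p 2) * v + s + g (p 1) * u) * hv
  · intro r t h
    change r.eval₂ g u + t.eval₂ g u * v = 0 at h
    rw [hev, hev] at h
    have ht : t = 0 := by
      by_contra ht
      have htρ : ρ t ≠ 0 := (map_ne_zero_iff ρ hρ).mpr ht
      have htj : j t ≠ 0 := (map_ne_zero_iff j hj).mpr ht
      apply hsF (ρ (C (p 1) * X * t - 2 * C (p 2) * r) / ρ t)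
      rw [map_div₀]
      change j _ / j t = s
      rw [div_eq_iff htj]
      simp only [map_sub, map_mul, map_ofNat]
      change g (p 1) * u * j t - 2 * g (p 2) * j r = _
      linear_combination j t * hv - 2 * g (p 2) * h
    subst ht
    refine ⟨?_, rfl⟩
    apply hj
    simpa using h

/-- `S` is the `A`-algebra presented by three generators `y` and the relations
`p · y = 0` and `y₀ y₂ = y₁ ^ 2 + 1`. -/
structure IsConicPresentation {A S : Type} [CommRing A] [CommRing S] (i : A →+* S)
    (p : Fin 3 → A) (y : Fin 3 → S) : Prop where
  linear : i (p 0) * y 0 + i (p 1) * y 1 + i (p 2) * y 2 = 0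
  quadratic : y 0 * y 2 = y 1 ^ 2 + 1
  induction : ∀ P : S → Prop, (∀ a, P (i a)) → (∀ f g, P f → P g → P (f + g)) →
    (∀ a f, P f → P (i a * f)) → (∀ k f, P f → P (y k * f)) → ∀ f, P f
  lift : ∀ (L : Type) [Field L] (g : A →+* L) (z : Fin 3 → L),
    g (p 0) * z 0 + g (p 1) * z 1 + g (p 2) * z 2 = 0 → z 0 * z 2 = z 1 ^ 2 + 1 →
    ∃ h : S →+* L, (∀ a, h (i a) = g a) ∧ ∀ k, h (y k) = z k

namespace IsConicPresentation

variable {A S : Type} [CommRing A] [CommRing S] {i : A →+* S} {p : Fin 3 → A} {y : Fin 3 → S}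

lemma swap (H : IsConicPresentation i p y) :
    IsConicPresentation i ![p 2, p 1, p 0] ![y 2, y 1, y 0] where
  linear := by
    change i (p 2) * y 2 + i (p 1) * y 1 + i (p 0) * y 0 = 0
    linear_combination H.linear
  quadratic := by
    change y 2 * y 0 = y 1 ^ 2 + 1
    linear_combination H.quadratic
  induction P h1 h2 h3 h4 := by
    refine H.induction P h1 h2 h3 fun k f hf => ?_
    fin_cases k
    · exact h4 2 f hf
    · exact h4 1 f hf
    · exact h4 0 f hf
  lift L _ g z hl hq := by
    change g (p 2) * z 0 + g (p 1) * z 1 + g (p 0) * z 2 = 0 at hl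
    obtain ⟨h, ha, hz⟩ := H.lift L g ![z 2, z 1, z 0]
      (by change g (p 0) * z 2 + g (p 1) * z 1 + g (p 2) * z 0 = 0; linear_combination hl)
      (by change z 2 * z 0 = z 1 ^ 2 + 1; linear_combination hq)
    refine ⟨h, ha, fun k => ?_⟩
    fin_cases k
    · exact hz 2
    · exact hz 1
    · exact hz 0

lemma shear (H : IsConicPresentation i p y) :
    IsConicPresentation i ![p 0, p 1 + 2 * p 0, p 2 + p 1 + p 0]
      ![y 0 - 2 * y 1 + y 2, y 1 - y 2, y 2] where
  linear := by
    change i (p 0) * (y 0 - 2 * y 1 + y 2) + i (p 1 + 2 * p 0) * (y 1 - y 2) +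
      i (p 2 + p 1 + p 0) * y 2 = 0
    simp only [map_add, map_mul, map_ofNat]
    linear_combination H.linear
  quadratic := by
    change (y 0 - 2 * y 1 + y 2) * y 2 = (y 1 - y 2) ^ 2 + 1
    linear_combination H.quadratic
  induction P h1 h2 h3 h4 := by
    refine H.induction P h1 h2 h3 fun k f hf => ?_
    have e0 : P ((y 0 - 2 * y 1 + y 2) * f) := h4 0 f hf
    have e1 : P ((y 1 - y 2) * f) := h4 1 f hf
    have e2 : P (y 2 * f) := h4 2 f hf
    have e3 : P (y 1 * f) := by
      convert h2 _ _ e1 e2 using 1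
      ring
    fin_cases k
    · convert h2 _ _ (h2 _ _ e0 (h3 2 _ e3)) (h3 (-1) _ e2) using 1
      simp only [map_neg, map_one, map_ofNat, Fin.zero_eta]
      ring
    · exact e3
    · exact e2
  lift L _ g z hl hq := by
    change g (p 0) * z 0 + g (p 1 + 2 * p 0) * z 1 + g (p 2 + p 1 + p 0) * z 2 = 0 at hl
    simp only [map_add, map_mul, map_ofNat] at hl
    obtain ⟨h, ha, hz⟩ := H.lift L g ![z 0 + 2 * z 1 + z 2, z 1 + z 2, z 2]
      (by
        change g (p 0) * (z 0 + 2 * z 1 + z 2) + g (p 1) * (z 1 + z 2) + g (p 2) * z 2 = 0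
        linear_combination hl)
      (by
        change (z 0 + 2 * z 1 + z 2) * z 2 = (z 1 + z 2) ^ 2 + 1
        linear_combination hq)
    have z0 : h (y 0) = z 0 + 2 * z 1 + z 2 := hz 0
    have z1 : h (y 1) = z 1 + z 2 := hz 1
    have z2 : h (y 2) = z 2 := hz 2
    refine ⟨h, ha, fun k => ?_⟩
    fin_cases k
    · change h (y 0 - 2 * y 1 + y 2) = z 0
      simp only [map_add, map_sub, map_mul, map_ofNat, z0, z1, z2]
      ring
    · change h (y 1 - y 2) = z 1
      simp only [map_sub, z1, z2]
      ring
    · exact z2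

lemma exists_reduction (H : IsConicPresentation i p y) (f : S) :
    ∃ (n : ℕ) (r s : A[X]), i (p 2) ^ n * f = r.eval₂ i (y 0) + s.eval₂ i (y 0) * y 1 := by
  refine H.induction (fun f => ∃ (n : ℕ) (r s : A[X]),
    i (p 2) ^ n * f = r.eval₂ i (y 0) + s.eval₂ i (y 0) * y 1) ?_ ?_ ?_ ?_ f
  · intro a
    exact ⟨0, C a, 0, by simp⟩
  · rintro f g ⟨n, r, s, h⟩ ⟨m, r', s', h'⟩
    refine ⟨n + m, C (p 2) ^ m * r + C (p 2) ^ n * r', C (p 2) ^ m * s + C (p 2) ^ n * s', ?_⟩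
    simp only [eval₂_add, eval₂_mul, eval₂_C, eval₂_pow]
    linear_combination i (p 2) ^ m * h + i (p 2) ^ n * h'
  · rintro a f ⟨n, r, s, h⟩
    refine ⟨n, C a * r, C a * s, ?_⟩
    simp only [eval₂_mul, eval₂_C]
    linear_combination i a * h
  · have key0 : ∀ f, (∃ (n : ℕ) (r s : A[X]),
        i (p 2) ^ n * f = r.eval₂ i (y 0) + s.eval₂ i (y 0) * y 1) → ∃ (n : ℕ) (r s : A[X]),
        i (p 2) ^ n * (y 0 * f) = r.eval₂ i (y 0) + s.eval₂ i (y 0) * y 1 := by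
      rintro f ⟨n, r, s, h⟩
      refine ⟨n, X * r, X * s, ?_⟩
      simp only [eval₂_mul, eval₂_X]
      linear_combination y 0 * h
    have key1 : ∀ f, (∃ (n : ℕ) (r s : A[X]),
        i (p 2) ^ n * f = r.eval₂ i (y 0) + s.eval₂ i (y 0) * y 1) → ∃ (n : ℕ) (r s : A[X]),
        i (p 2) ^ n * (y 1 * f) = r.eval₂ i (y 0) + s.eval₂ i (y 0) * y 1 := by
      rintro f ⟨n, r, s, h⟩
      refine ⟨n + 1, -(s * (C (p 0) * X ^ 2 + C (p 2))), C (p 2) * r - s * C (p 1) * X, ?_⟩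
      simp only [eval₂_mul, eval₂_X, eval₂_add, eval₂_sub, eval₂_neg, eval₂_C, eval₂_pow]
      linear_combination i (p 2) * y 1 * h +
        s.eval₂ i (y 0) * (y 0 * H.linear - i (p 2) * H.quadratic)
    intro k f hf
    fin_cases k
    · exact key0 f hf
    · exact key1 f hf
    · obtain ⟨n, r, s, h⟩ := key0 f hf
      obtain ⟨m, r', s', h'⟩ := key1 f hf
      refine ⟨n + m + 1, -(C (p 0) * C (p 2) ^ m * r + C (p 1) * C (p 2) ^ n * r'),
        -(C (p 0) * C (p 2) ^ m * s + C (p 1) * C (p 2) ^ n * s'), ?_⟩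
      simp only [eval₂_mul, eval₂_add, eval₂_neg, eval₂_C, eval₂_pow, Fin.reduceFinMk]
      linear_combination i (p 2) ^ (n + m) * f * H.linear - i (p 0) * i (p 2) ^ m * h -
        i (p 1) * i (p 2) ^ n * h'

lemma exists_hom (H : IsConicPresentation i p y) [IsDomain A] (h2 : (2 : A) ≠ 0)
    (hp : p 2 ≠ 0) (hD : p 1 ^ 2 - 4 * p 0 * p 2 ≠ 0) :
    ∃ (L : Type) (_ : Field L) (h : S →+* L), (∀ a, h (i a) = 0 → a = 0) ∧
      ∀ f, h f = 0 → ∃ n : ℕ, i (p 2) ^ n * f = 0 := by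
  obtain ⟨L, _, g, z, hg, hl, hq, hz⟩ := exists_generic_conic_point h2 p hp hD
  obtain ⟨h, ha, hy⟩ := H.lift L g z hl hq
  have hcomp : h.comp i = g := RingHom.ext ha
  refine ⟨L, inferInstance, h, fun a h0 => ?_, fun f hf => ?_⟩
  · rw [ha] at h0
    exact (map_eq_zero_iff g hg).mp h0
  · obtain ⟨n, r, s, e⟩ := H.exists_reduction f
    have e' := congrArg h e
    rw [map_mul, hf, mul_zero, map_add, map_mul, hom_eval₂, hom_eval₂, hcomp, hy, hy] at e'
    obtain ⟨rfl, rfl⟩ := hz r s e'.symm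
    exact ⟨n, by simpa using e⟩

lemma isDomain (H : IsConicPresentation i p y) [IsDomain A] (h2 : (2 : A) ≠ 0)
    (hp0 : p 0 ≠ 0) (hp2 : p 2 ≠ 0) (hps : p 2 + p 1 + p 0 ≠ 0)
    (hD : p 1 ^ 2 - 4 * p 0 * p 2 ≠ 0) (hspan : Ideal.span {p 2, p 0, p 2 + p 1 + p 0} = ⊤) :
    IsDomain S := by
  obtain ⟨L0, _, h0, hi0, ht0⟩ := H.exists_hom h2 hp2 hD
  obtain ⟨L1, _, h1, hi1, ht1⟩ := H.swap.exists_hom h2 hp0 (by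
    change p 1 ^ 2 - 4 * p 2 * p 0 ≠ 0
    convert hD using 1
    ring)
  obtain ⟨L2, _, h3, hi2, ht2⟩ := H.shear.exists_hom h2 hps (by
    change (p 1 + 2 * p 0) ^ 2 - 4 * p 0 * (p 2 + p 1 + p 0) ≠ 0
    convert hD using 1
    ring)
  change ∀ f, h1 f = 0 → ∃ n : ℕ, i (p 0) ^ n * f = 0 at ht1
  change ∀ f, h3 f = 0 → ∃ n : ℕ, i (p 2 + p 1 + p 0) ^ n * f = 0 at ht2
  have transfer : ∀ (L : Type) [Field L] (h : S →+* L), (∀ a, h (i a) = 0 → a = 0) →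
      ∀ f, h0 f = 0 → h f = 0 := by
    intro L _ h hi f hf
    obtain ⟨n, hn⟩ := ht0 f hf
    have := congrArg h hn
    rw [map_mul, map_pow, map_zero] at this
    exact (mul_eq_zero.mp this).resolve_left (pow_ne_zero _ fun e => hp2 (hi _ e))
  have hinj : ∀ f, h0 f = 0 → f = 0 := by
    intro f hf
    obtain ⟨n0, e0⟩ := ht0 f hf
    obtain ⟨n1, e1⟩ := ht1 f (transfer L1 h1 hi1 f hf)
    obtain ⟨n2, e2⟩ := ht2 f (transfer L2 h3 hi2 f hf)
    let J : Ideal A := Ideal.comap i (LinearMap.ker (LinearMap.toSpanSingleton S S f))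
    have hJ : ∀ a, a ∈ J ↔ i a * f = 0 := fun a => by simp [J]
    have pow_mem : ∀ (a : A) (n N : ℕ), n ≤ N → i a ^ n * f = 0 → a ^ N ∈ J := by
      intro a n N hN e
      obtain ⟨m, rfl⟩ := Nat.exists_eq_add_of_le hN
      rw [hJ, map_pow, pow_add]
      linear_combination i a ^ m * e
    have hle : Ideal.span ((fun x => x ^ (n0 + n1 + n2)) '' {p 2, p 0, p 2 + p 1 + p 0}) ≤ J := by
      rw [Ideal.span_le]
      rintro _ ⟨x, rfl | rfl | rfl, rfl⟩
      · exact pow_mem _ n0 _ (by omega) e0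
      · exact pow_mem _ n1 _ (by omega) e1
      · exact pow_mem _ n2 _ (by omega) e2
    rw [Ideal.span_pow_eq_top _ hspan] at hle
    simpa using (hJ 1).mp (hle trivial)
  exact ((injective_iff_map_eq_zero h0).mpr hinj).isDomain h0

end IsConicPresentation

end

open MvPolynomial in
/-- The inclusion of the polynomial ring in the first three of six variables. -/
noncomputable def firstThree : MvPolynomial (Fin 3) ℚ →+* MvPolynomial (Fin 6) ℚ :=
  eval₂Hom C ![X 0, X 1, X 2]

open MvPolynomial in
/-- The ideal generated by an ideal in the first three variables and the equations of an affine
conic in the last three variables. -/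
noncomputable def conicIdeal (a : Ideal (MvPolynomial (Fin 3) ℚ))
    (p : Fin 3 → MvPolynomial (Fin 3) ℚ) : Ideal (MvPolynomial (Fin 6) ℚ) :=
  a.map firstThree ⊔ Ideal.span {X 3 * X 5 - X 4 ^ 2 - 1,
    firstThree (p 0) * X 3 + firstThree (p 1) * X 4 + firstThree (p 2) * X 5}

open MvPolynomial in
lemma isConicPresentation_conicIdeal (a : Ideal (MvPolynomial (Fin 3) ℚ))
    (p : Fin 3 → MvPolynomial (Fin 3) ℚ) :
    IsConicPresentation
      (Ideal.quotientMap (I := a) (conicIdeal a p) firstThree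
        (Ideal.le_comap_of_map_le le_sup_left))
      (fun k => Ideal.Quotient.mk a (p k))
      (fun k => Ideal.Quotient.mk (conicIdeal a p) (![X 3, X 4, X 5] k)) where
  linear := by
    simp only [Ideal.quotientMap_mk, ← map_mul, ← map_add]
    exact Ideal.Quotient.eq_zero_iff_mem.mpr
      (Ideal.mem_sup_right (Ideal.subset_span (Or.inr rfl)))
  quadratic := by
    rw [← sub_eq_zero, ← map_one (Ideal.Quotient.mk _)]
    simp only [← map_mul, ← map_add, ← map_pow, ← map_sub]
    rw [Ideal.Quotient.eq_zero_iff_mem]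
    refine Ideal.mem_sup_right (Ideal.subset_span (Or.inl ?_))
    change X 3 * X 5 - (X 4 ^ 2 + 1) = _
    ring
  induction P h1 h2 h3 h4 f := by
    obtain ⟨f, rfl⟩ := Ideal.Quotient.mk_surjective f
    induction f using MvPolynomial.induction_on with
    | C r =>
      convert h1 (Ideal.Quotient.mk a (C r))
      simp [firstThree]
    | add f g hf hg =>
      rw [map_add]
      exact h2 _ _ hf hg
    | mul_X f k hf =>
      rw [mul_comm, map_mul]
      have hx : ∀ k : Fin 3, P (Ideal.Quotient.mk _ (firstThree (X k)) * Ideal.Quotient.mk _ f) :=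
        fun k => h3 (Ideal.Quotient.mk a (X k)) _ hf
      simp only [firstThree, eval₂Hom_X'] at hx
      fin_cases k
      · exact hx 0
      · exact hx 1
      · exact hx 2
      · exact h4 0 _ hf
      · exact h4 1 _ hf
      · exact h4 2 _ hf
  lift L _ g z hl hq := by
    let x : Fin 3 → L := fun k => g (Ideal.Quotient.mk a (X k))
    let h : MvPolynomial (Fin 6) ℚ →+* L :=
      eval₂Hom ((g.comp (Ideal.Quotient.mk a)).comp C) ![x 0, x 1, x 2, z 0, z 1, z 2]
    have h3 : h (X 3) = z 0 := eval₂Hom_X' _ _ _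
    have h4 : h (X 4) = z 1 := eval₂Hom_X' _ _ _
    have h5 : h (X 5) = z 2 := eval₂Hom_X' _ _ _
    have hcomp : h.comp firstThree = g.comp (Ideal.Quotient.mk a) := by
      apply MvPolynomial.ringHom_ext
      · intro r
        simp only [RingHom.comp_apply, h, firstThree, eval₂Hom_C]
      · intro k
        fin_cases k <;> simp [h, firstThree, x]
    have hc : ∀ b, h (firstThree b) = g (Ideal.Quotient.mk a b) := RingHom.congr_fun hcomp
    have hle : conicIdeal a p ≤ RingHom.ker h := by
      refine sup_le (Ideal.map_le_iff_le_comap.mpr fun b hb => ?_) (Ideal.span_le.mpr ?_)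
      · rw [Ideal.mem_comap, RingHom.mem_ker, hc, Ideal.Quotient.eq_zero_iff_mem.mpr hb, map_zero]
      · rintro _ (rfl | rfl)
        · rw [SetLike.mem_coe, RingHom.mem_ker]
          simp only [map_sub, map_mul, map_pow, map_one, h3, h4, h5]
          linear_combination hq
        · rw [SetLike.mem_coe, RingHom.mem_ker]
          simp only [map_add, map_mul, hc, h3, h4, h5]
          exact hl
    refine ⟨Ideal.Quotient.lift _ h fun b hb => RingHom.mem_ker.mp (hle hb), fun b => ?_, fun k => ?_⟩
    · obtain ⟨b, rfl⟩ := Ideal.Quotient.mk_surjective b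
      rw [Ideal.quotientMap_mk, Ideal.Quotient.lift_mk, hc]
    · rw [Ideal.Quotient.lift_mk]
      fin_cases k
      · exact h3
      · exact h4
      · exact h5

open MvPolynomial in
lemma prime_X_mul_X_sub_X_sq_sub_one {σ : Type} {i j k : σ} (hik : i ≠ k) (hjk : j ≠ k) :
    Prime (X i * X k - X j ^ 2 - 1 : MvPolynomial σ ℚ) := by
  classical
  rw [← irreducible_iff_prime]
  have e : (X i * X k - X j ^ 2 - 1 : MvPolynomial σ ℚ) = X i * X k + (-(X j ^ 2 + 1)) := by ring
  rw [e]
  refine irreducible_mul_X_add _ _ _ (X_ne_zero i) ?_ ?_ ?_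
  · simpa [vars_X] using hik.symm
  · rw [vars_neg]
    intro h
    rcases Finset.mem_union.mp (vars_add_subset _ _ h) with h | h
    · have := vars_pow _ _ h
      rw [vars_X, Finset.mem_singleton] at this
      exact hjk this.symm
    · simp at h
  · rw [(X_prime (R := ℚ) (i := i)).irreducible.isRelPrime_iff_not_dvd]
    rintro ⟨q, hq⟩
    have := congrArg (eval fun _ => 0) hq
    simp at this

open MvPolynomial in
/-- Coefficients of the bilinear form `Φ` with respect to the last three variables. -/
noncomputable def conicCoeff (a11 a12 a21 a22 : ℚ) : Fin 3 → MvPolynomial (Fin 3) ℚ :=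
  ![C a11 * X 1 + C a21 * X 2, -C a11 * X 0 + C (a12 - a21) * X 1 + C a22 * X 2,
    -C a12 * X 0 - C a22 * X 1]

open MvPolynomial in
theorem stmt_19 (a11 a12 a21 a22 : ℤ)
    (hdet : a11 * a22 - a12 * a21 = 1)
    (hsym : a12 ≠ a21)
    (hskew : ¬(a11 = 0 ∧ a22 = 0 ∧ a12 = -a21))
    (I : Ideal (MvPolynomial (Fin 6) ℚ))
    (hI : I = Ideal.span
      {X 0 * X 2 - X 1 ^ 2 - 1,
       X 3 * X 5 - X 4 ^ 2 - 1,
       C (a11 : ℚ) * (X 3 * X 1 - X 4 * X 0) + C (a12 : ℚ) * (X 4 * X 1 - X 5 * X 0)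
         + C (a21 : ℚ) * (X 3 * X 2 - X 4 * X 1)
         + C (a22 : ℚ) * (X 4 * X 2 - X 5 * X 1)}) :
    ∃ h : I.IsPrime, Order.height (⟨I, h⟩ : PrimeSpectrum (MvPolynomial (Fin 6) ℚ)) = 3 := by
  have hdet' : (a11 : ℚ) * a22 - a12 * a21 = 1 := by exact_mod_cast hdet
  have hsym' : (a12 : ℚ) ≠ a21 := by exact_mod_cast hsym
  clear hdet hsym hskew
  generalize (a11 : ℚ) = b11 at *
  generalize (a12 : ℚ) = b12 at *
  generalize (a21 : ℚ) = b21 at *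
  generalize (a22 : ℚ) = b22 at *
  let f : MvPolynomial (Fin 3) ℚ := X 0 * X 2 - X 1 ^ 2 - 1
  let Φ : MvPolynomial (Fin 6) ℚ := C b11 * (X 3 * X 1 - X 4 * X 0)
    + C b12 * (X 4 * X 1 - X 5 * X 0) + C b21 * (X 3 * X 2 - X 4 * X 1)
    + C b22 * (X 4 * X 2 - X 5 * X 1)
  let q : MvPolynomial (Fin 6) ℚ := X 3 * X 5 - X 4 ^ 2 - 1
  let a := Ideal.span {f}
  let p := conicCoeff b11 b12 b21 b22
  have hΦ : firstThree (p 0) * X 3 + firstThree (p 1) * X 4 + firstThree (p 2) * X 5 = Φ := by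
    simp [p, conicCoeff, firstThree, Φ]
    ring
  have hfp : Prime f := prime_X_mul_X_sub_X_sq_sub_one (by decide) (by decide)
  have ha : a.IsPrime := (Ideal.span_singleton_prime hfp.ne_zero).mpr hfp
  have not_mem : ∀ (v : Fin 3 → ℚ) (g : MvPolynomial (Fin 3) ℚ), v 0 * v 2 - v 1 ^ 2 - 1 = 0 →
      g ∈ a → eval v g = 0 := by
    intro v g hv hg
    obtain ⟨c, rfl⟩ := Ideal.mem_span_singleton.mp hg
    simp [f, hv]
  have hp0 : p 0 ∉ a := by
    intro h
    have e1 := not_mem ![1, 0, 1] _ (by simp) h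
    have e2 := not_mem ![1, 1, 2] _ (by simp; norm_num) h
    simp [p, conicCoeff] at e1 e2
    simp_all
  have hp2 : p 2 ∉ a := by
    intro h
    have e1 := not_mem ![1, 0, 1] _ (by simp) h
    have e2 := not_mem ![1, 1, 2] _ (by simp; norm_num) h
    simp [p, conicCoeff] at e1 e2
    simp_all
  have hps : p 2 + p 1 + p 0 ∉ a := by
    intro h
    have e1 := not_mem ![1, 0, 1] _ (by simp) h
    have e2 := not_mem ![2, 0, 1 / 2] _ (by simp) h
    simp [p, conicCoeff] at e1 e2
    have e3 : b11 = -b12 := by linarith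
    have e4 : b21 = -b22 := by linarith
    subst e3 e4
    linarith
  have hD : p 1 ^ 2 - 4 * p 0 * p 2 ∉ a := by
    intro h
    have e1 := not_mem ![1, 0, 1] _ (by simp) h
    have e2 := not_mem ![2, 0, 1 / 2] _ (by simp) h
    have e3 := not_mem ![3, 0, 1 / 3] _ (by simp) h
    simp [p, conicCoeff] at e1 e2 e3
    have e4 : b11 ^ 2 = 0 := by linarith
    have e5 : b22 ^ 2 = 0 := by linarith
    have e6 : b11 = 0 := by simpa using e4
    have e7 : b22 = 0 := by simpa using e5
    subst e6 e7
    linarith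
  have hspan : ∀ J : Ideal (MvPolynomial (Fin 3) ℚ), f ∈ J → p 2 ∈ J → p 0 ∈ J →
      p 2 + p 1 + p 0 ∈ J → (1 : MvPolynomial (Fin 3) ℚ) ∈ J := by
    intro J hf h2 h0 hs
    have h1 : p 1 ∈ J := by
      have := J.sub_mem (J.sub_mem hs h2) h0
      ring_nf at this
      exact this
    have hC : (C b11 * C b22 - C b12 * C b21 : MvPolynomial (Fin 3) ℚ) = 1 := by
      rw [← C_mul, ← C_mul, ← C_sub, hdet', C_1]
    have comb : ∀ u v w, u * p 0 + v * p 1 + w * p 2 ∈ J := fun u v w =>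
      J.add_mem (J.add_mem (J.mul_mem_left u h0) (J.mul_mem_left v h1)) (J.mul_mem_left w h2)
    have e0 : p 0 = C b11 * X 1 + C b21 * X 2 := rfl
    have e1 : p 1 = -C b11 * X 0 + (C b12 - C b21) * X 1 + C b22 * X 2 := by
      rw [← C_sub]; rfl
    have e2 : p 2 = -C b12 * X 0 - C b22 * X 1 := rfl
    have m0 : (C b12 - C b21) * X 0 ∈ J := by
      convert comb (-C b22 ^ 2) (C b21 * C b22)
        (-(C b11 * C b22 - C b21 * (C b12 - C b21))) using 1
      rw [e0, e1, e2]
      linear_combination (-(C b12 - C b21) * X 0) * hC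
    have m1 : (C b12 - C b21) * X 1 ∈ J := by
      convert comb (C b22 * C b12) (-(C b12 * C b21)) (C b11 * C b21) using 1
      rw [e0, e1, e2]
      linear_combination (-(C b12 - C b21) * X 1) * hC
    have m3 : C ((b12 - b21) ^ 2) ∈ J := by
      convert J.sub_mem (J.sub_mem (J.mul_mem_right ((C b12 - C b21) * X 2) m0)
        (J.mul_mem_left ((C b12 - C b21) * X 1) m1)) (J.mul_mem_left ((C b12 - C b21) ^ 2) hf)
        using 1
      simp only [f, C_pow, C_sub]
      ring
    have := J.mul_mem_left (C ((b12 - b21) ^ 2)⁻¹) m3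
    rwa [← C_mul, inv_mul_cancel₀ (pow_ne_zero _ (sub_ne_zero.mpr hsym')), C_1] at this
  have hIeq : I = conicIdeal a p := by
    rw [hI, conicIdeal, hΦ, Ideal.map_span, ← Ideal.span_union, Set.image_singleton,
      Set.singleton_union]
    simp [f, firstThree, Φ]
  have : CharZero (MvPolynomial (Fin 3) ℚ ⧸ a) := algebraRat.charZero _
  have mk_ne : ∀ b, b ∉ a → Ideal.Quotient.mk a b ≠ 0 := fun b hb h =>
    hb (Ideal.Quotient.eq_zero_iff_mem.mp h)
  have hdom : IsDomain (MvPolynomial (Fin 6) ℚ ⧸ conicIdeal a p) := by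
    refine (isConicPresentation_conicIdeal a p).isDomain two_ne_zero (mk_ne _ hp0) (mk_ne _ hp2)
      (mk_ne _ hps) (mk_ne _ hD) ?_
    rw [Ideal.eq_top_iff_one]
    rw [← map_one (Ideal.Quotient.mk a), ← Ideal.mem_comap]
    refine hspan _ ?_ ?_ ?_ ?_
    · rw [Ideal.mem_comap, Ideal.Quotient.eq_zero_iff_mem.mpr (Ideal.mem_span_singleton_self f)]
      exact Ideal.zero_mem _
    · exact Ideal.subset_span (by simp)
    · exact Ideal.subset_span (by simp)
    · exact Ideal.subset_span (by simp)
  have hprime : I.IsPrime := by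
    rw [hIeq]
    exact (Ideal.Quotient.isDomain_iff_prime _).mp hdom
  have hqp : Prime q := prime_X_mul_X_sub_X_sq_sub_one (by decide) (by decide)
  have hP1 : (Ideal.span {q}).IsPrime := (Ideal.span_singleton_prime hqp.ne_zero).mpr hqp
  have hfI : firstThree f ∈ I := by
    rw [hIeq]
    exact Ideal.mem_sup_left (Ideal.mem_map_of_mem _ (Ideal.mem_span_singleton_self f))
  have hp2I : firstThree (p 2) ∉ I := by
    intro h
    obtain ⟨L, _, g, hi, -⟩ := (isConicPresentation_conicIdeal a p).exists_hom two_ne_zero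
      (mk_ne _ hp2) (mk_ne _ hD)
    refine mk_ne _ hp2 (hi _ ?_)
    rw [hIeq] at h
    rw [Ideal.quotientMap_mk, Ideal.Quotient.eq_zero_iff_mem.mpr h, map_zero]
  obtain ⟨P, hP, hqP, hΦP, hfP, hPI⟩ : ∃ P : Ideal (MvPolynomial (Fin 6) ℚ), P.IsPrime ∧ q ∈ P ∧
      Φ ∈ P ∧ firstThree f ∉ P ∧ P ≤ I := by
    have : CharZero (MvPolynomial (Fin 3) ℚ ⧸ (⊥ : Ideal (MvPolynomial (Fin 3) ℚ))) :=
      algebraRat.charZero _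
    have mk_ne : ∀ b, b ∉ a → Ideal.Quotient.mk (⊥ : Ideal (MvPolynomial (Fin 3) ℚ)) b ≠ 0 := by
      intro b hb h
      rw [Ideal.Quotient.eq_zero_iff_mem, Ideal.mem_bot] at h
      exact hb (h ▸ a.zero_mem)
    obtain ⟨L, _, h, hi, ht⟩ := (isConicPresentation_conicIdeal ⊥ p).exists_hom two_ne_zero
      (mk_ne _ hp2) (mk_ne _ hD)
    have hle : conicIdeal ⊥ p ≤ RingHom.ker (h.comp (Ideal.Quotient.mk (conicIdeal ⊥ p))) := by
      intro b hb
      rw [RingHom.mem_ker, RingHom.comp_apply, Ideal.Quotient.eq_zero_iff_mem.mpr hb, map_zero]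
    refine ⟨RingHom.ker (h.comp (Ideal.Quotient.mk (conicIdeal ⊥ p))), RingHom.ker_isPrime _,
      hle (Ideal.mem_sup_right (Ideal.subset_span (Or.inl rfl))),
      hle (Ideal.mem_sup_right (Ideal.subset_span (Or.inr hΦ.symm))), ?_, ?_⟩
    · intro hf
      have := hi (Ideal.Quotient.mk ⊥ f) hf
      rw [Ideal.Quotient.eq_zero_iff_mem, Ideal.mem_bot] at this
      exact hfp.ne_zero this
    · intro b hb
      obtain ⟨n, hn⟩ := ht _ hb
      rw [Ideal.quotientMap_mk, ← map_pow, ← map_mul, Ideal.Quotient.eq_zero_iff_mem] at hn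
      have hmem : firstThree (p 2) ^ n * b ∈ I := by
        rw [hIeq]
        have hbot : Ideal.map firstThree ⊥ ≤ Ideal.map firstThree a := Ideal.map_mono bot_le
        exact (sup_le_sup_right hbot _ : conicIdeal ⊥ p ≤ conicIdeal a p) hn
      exact (hprime.mem_or_mem hmem).resolve_left fun e => hp2I (hprime.mem_of_pow_mem n e)
  refine ⟨hprime, le_antisymm ?_ ?_⟩
  · rw [← PrimeSpectrum.height_eq_orderHeight]
    classical
    have hfin : I = Ideal.span (({firstThree f, q, Φ} : Finset (MvPolynomial (Fin 6) ℚ)) :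
        Set (MvPolynomial (Fin 6) ℚ)) := by
      rw [hI]
      simp [f, firstThree, Φ, q]
    have hmin : I ∈ (Ideal.span (({firstThree f, q, Φ} : Finset (MvPolynomial (Fin 6) ℚ)) :
        Set (MvPolynomial (Fin 6) ℚ))).minimalPrimes := by
      rw [← hfin, Ideal.minimalPrimes_eq_subsingleton_self]
      exact Set.mem_singleton I
    exact (Ideal.height_le_card_of_mem_minimalPrimes_span_finset hmin).trans
      (by exact_mod_cast Finset.card_le_three)
  · rw [← PrimeSpectrum.height_eq_orderHeight]
    have lt1 : (⊥ : Ideal (MvPolynomial (Fin 6) ℚ)) < Ideal.span {q} := by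
      rw [bot_lt_iff_ne_bot, Ne, Ideal.span_singleton_eq_bot]
      exact hqp.ne_zero
    have lt2 : Ideal.span {q} < P := by
      refine lt_of_le_of_ne ((Ideal.span_singleton_le_iff_mem P).mpr hqP) fun e => ?_
      rw [← e] at hΦP
      obtain ⟨c, hc⟩ := Ideal.mem_span_singleton.mp hΦP
      have e1 := congrArg (eval ![1, 0, 1, 1, 0, 1]) hc
      simp [Φ, q] at e1
      exact hsym' (by linarith)
    have lt3 : P < I := lt_of_le_of_ne hPI fun e => hfP (e ▸ hfI)
    have h1 := Ideal.height_add_one_le_of_lt_of_isPrime lt1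
    have h2 := Ideal.height_add_one_le_of_lt_of_isPrime lt2
    have h3 := Ideal.height_add_one_le_of_lt_of_isPrime lt3
    calc (3 : ℕ∞) = 0 + 1 + 1 + 1 := by norm_num
      _ ≤ (⊥ : Ideal (MvPolynomial (Fin 6) ℚ)).height + 1 + 1 + 1 := by gcongr; exact zero_le
      _ ≤ (Ideal.span {q}).height + 1 + 1 := by gcongr
      _ ≤ P.height + 1 := by gcongr
      _ ≤ I.height := h3
end
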